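/- For every β ∈ (2,∞) there exist C_β > 0 and λ₀ ∈ (0,1/2) such that for all λ ∈ (0,λ₀) and all integers N ≥ 1, log Z_{N,β}^λ ≥ 2N log N + N(2−β) log λ + N(log 𝒵_β − 1) − C_β N ( λ^{β−2}·1_{β<4} + λ²|log λ|²·1_{β=4} + λ²|log λ|·1_{β>4} ). -/

import Mathlib

open MeasureTheory Real
open scoped ENNReal NNReal BigOperators Classical

noncomputable section

/-- The plane `ℝ²`. -/
abbrev E2 := EuclideanSpace ℝ (Fin 2)

/-- The logarithmic Coulomb kernel `g(x) = -log |x|`. -/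
def gfun (x : E2) : ℝ := -Real.log ‖x‖

/-- The uniform probability measure on the closed ball `B(z, lam)` (smeared charge). -/
def udisc (z : E2) (lam : ℝ) : MeasureTheory.Measure E2 :=
  (MeasureTheory.volume (Metric.closedBall z lam))⁻¹ •
    MeasureTheory.volume.restrict (Metric.closedBall z lam)

/-- The smeared interaction `g_lam(z) = ∬ g(x-y) dδ_0^{(lam)}(x) dδ_z^{(lam)}(y)`. -/
def gsm (lam : ℝ) (z : E2) : ℝ :=
  ∫ x, (∫ y, gfun (x - y) ∂(udisc z lam)) ∂(udisc 0 lam)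

/-- `κ = g_1(0)`. -/
def kappa : ℝ := gsm 1 0

/-- The (renormalized) energy `F_lam(X_N, Y_N)`. -/
def Flam (N : ℕ) (lam : ℝ) (X Y : Fin N → E2) : ℝ :=
  (1/2) * (∑ i : Fin N, ∑ j : Fin N,
      (gsm lam (X i - X j) + gsm lam (Y i - Y j) - 2 * gsm lam (X i - Y j)))
    - N * (-Real.log lam + kappa)

/-- The box `Λ = [0, √N]²`. -/
def LamBox (N : ℕ) : Set E2 := {x | ∀ i, x i ∈ Set.Icc (0:ℝ) (Real.sqrt N)}

/-- The configuration space `Λ^N × Λ^N`. -/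
def confSet (N : ℕ) : Set ((Fin N → E2) × (Fin N → E2)) :=
  {P | (∀ i, P.1 i ∈ LamBox N) ∧ (∀ i, P.2 i ∈ LamBox N)}

/-- The partition function `Z_{N,β}^{lam}`. -/
def Zpart (N : ℕ) (β lam : ℝ) : ℝ :=
  ∫ P in confSet N, Real.exp (-β * Flam N lam P.1 P.2)

/-- `g_1` evaluated at (any) point of norm `r` (it is radial). -/
def g1rad (r : ℝ) : ℝ := gsm 1 (EuclideanSpace.single (0 : Fin 2) r)

/-- The constant `𝒵_β`. -/
def Zbeta (β : ℝ) : ℝ :=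
  if β = 2 then 2 * Real.pi
  else 2 * Real.pi * ∫ r in Set.Ioi (0:ℝ), Real.exp (β * g1rad r) * r

/-- The error rate `ω_lam` (with `M₀ = 36`). -/
def omegaL (β lam : ℝ) : ℝ :=
  if β = 2 then |Real.log lam| ^ (-(1:ℝ)/(5+36))
  else if β < 4 then lam ^ ((2*(β-2))/(12-β+36))
  else if β = 4 then (lam * |Real.log lam|) ^ ((1:ℝ)/(2+36))
  else lam ^ ((1:ℝ)/(2+36))

theorem sum_perm_prod_div_le_one {N : ℕ} (a : Fin N → Fin N → ℝ) (ha : ∀ i j, 0 < a i j) :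
    ∑ σ : Equiv.Perm (Fin N), ∏ i, (a i (σ i) / ∑ j, a i j) ≤ 1 := by
  have hpos : ∀ i, 0 < ∑ j, a i j := fun i =>
    Finset.sum_pos (fun j _ => ha i j) ⟨i, Finset.mem_univ i⟩
  have h1 : ∏ i, ∑ j, (a i j / ∑ k, a i k) = 1 := by
    refine Finset.prod_eq_one fun i _ => ?_
    rw [← Finset.sum_div, div_self (hpos i).ne']
  rw [← h1, Finset.prod_univ_sum, Fintype.piFinset_univ]
  let e : Equiv.Perm (Fin N) ↪ (Fin N → Fin N) := ⟨fun σ => σ, DFunLike.coe_injective⟩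
  have h2 : ∑ σ : Equiv.Perm (Fin N), ∏ i, (a i (σ i) / ∑ j, a i j) =
      ∑ f ∈ Finset.univ.map e, ∏ i, (a i (f i) / ∑ j, a i j) := by
    rw [Finset.sum_map]; rfl
  rw [h2]
  refine Finset.sum_le_sum_of_subset_of_nonneg (Finset.subset_univ _) fun f _ _ => ?_
  exact Finset.prod_nonneg fun i _ => (div_pos (ha i _) (hpos i)).le

theorem one_add_sum_le_prod_one_add' {ι : Type*} (s : Finset ι) (b : ι → ℝ)
    (hb : ∀ i ∈ s, 0 ≤ b i) : 1 + ∑ i ∈ s, b i ≤ ∏ i ∈ s, (1 + b i) := by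
  induction s using Finset.induction_on with
  | empty => simp
  | insert i s hi ih =>
    rw [Finset.sum_insert hi, Finset.prod_insert hi]
    have h1 := ih fun j hj => hb j (Finset.mem_insert_of_mem hj)
    have h2 := hb i (Finset.mem_insert_self i s)
    have h3 : 0 ≤ ∑ j ∈ s, b j :=
      Finset.sum_nonneg fun j hj => hb j (Finset.mem_insert_of_mem hj)
    nlinarith

theorem exp_neg_sum_log_le_prod_div {N : ℕ} (a : Fin N → Fin N → ℝ) (ha : ∀ i j, 0 < a i j) :
    Real.exp (-∑ i, ∑ j ∈ Finset.univ.erase i, Real.log (1 + a i j / a i i)) ≤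
      ∏ i, (a i i / ∑ j, a i j) := by
  have hpos : ∀ i, 0 < ∑ j, a i j := fun i =>
    Finset.sum_pos (fun j _ => ha i j) ⟨i, Finset.mem_univ i⟩
  rw [← Finset.sum_neg_distrib, Real.exp_sum]
  refine Finset.prod_le_prod (fun i _ => (Real.exp_pos _).le) fun i _ => ?_
  have hd : ∀ j, 0 < a i j / a i i := fun j => div_pos (ha i j) (ha i i)
  have h1 : Real.exp (∑ j ∈ Finset.univ.erase i, Real.log (1 + a i j / a i i)) =
      ∏ j ∈ Finset.univ.erase i, (1 + a i j / a i i) := by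
    rw [Real.exp_sum]
    exact Finset.prod_congr rfl fun j _ => Real.exp_log (by linarith [hd j])
  have h2 : (∑ j, a i j) / a i i = 1 + ∑ j ∈ Finset.univ.erase i, a i j / a i i := by
    rw [Finset.sum_div, ← Finset.add_sum_erase _ _ (Finset.mem_univ i), div_self (ha i i).ne']
  rw [Real.exp_neg, h1, ← inv_div]
  gcongr
  · exact div_pos (hpos i) (ha i i)
  · rw [h2]
    exact one_add_sum_le_prod_one_add' _ _ fun j _ => (hd j).le

/-- The interaction between two dipoles `d` and `d'`. -/
def dipoleInt {α : Type*} (g : α → α → ℝ) (d d' : α × α) : ℝ :=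
  g d.1 d'.1 + g d.2 d'.2 - g d.1 d'.2 - g d.2 d'.1

/-- The energy of a configuration of `N` dipoles, for a kernel with diagonal value `c`. -/
def pairEnergy {α : Type*} (N : ℕ) (g : α → α → ℝ) (c : ℝ) (X Y : Fin N → α) : ℝ :=
  (1 / 2) * (∑ i, ∑ j, (g (X i) (X j) + g (Y i) (Y j) - 2 * g (X i) (Y j))) - N * c

theorem neg_pairEnergy_eq {α : Type*} {N : ℕ} {g : α → α → ℝ} {c : ℝ}
    (hsymm : ∀ x y, g x y = g y x) (hdiag : ∀ x, g x x = c) (X Y : Fin N → α) :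
    -pairEnergy N g c X Y = ∑ i, g (X i) (Y i) -
      ∑ i, ∑ j ∈ Finset.univ.erase i, (1 / 2) * dipoleInt g (X i, Y i) (X j, Y j) := by
  have h1 : ∑ i, ∑ j, (g (X i) (X j) + g (Y i) (Y j) - 2 * g (X i) (Y j)) =
      ∑ i, ∑ j, dipoleInt g (X i, Y i) (X j, Y j) := by
    have h2 : ∑ i, ∑ j, g (X i) (Y j) = ∑ i, ∑ j, g (Y i) (X j) := by
      rw [Finset.sum_comm]
      exact Finset.sum_congr rfl fun i _ => Finset.sum_congr rfl fun j _ => hsymm _ _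
    simp only [dipoleInt, Finset.sum_add_distrib, Finset.sum_sub_distrib, ← Finset.mul_sum]
    linarith
  have h3 : ∀ i, ∑ j, dipoleInt g (X i, Y i) (X j, Y j) = (2 * c - 2 * g (X i) (Y i)) +
      ∑ j ∈ Finset.univ.erase i, dipoleInt g (X i, Y i) (X j, Y j) := by
    intro i
    rw [← Finset.add_sum_erase _ _ (Finset.mem_univ i)]
    congr 1
    simp only [dipoleInt, hdiag, hsymm (Y i) (X i)]
    ring
  rw [pairEnergy, h1, Finset.sum_congr rfl fun i _ => h3 i, Finset.sum_add_distrib]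
  simp only [← Finset.mul_sum, Finset.sum_sub_distrib, Finset.sum_const, Finset.card_univ,
    Fintype.card_fin, nsmul_eq_mul]
  ring

theorem pairEnergy_comp_perm {α : Type*} {N : ℕ} (g : α → α → ℝ) (c : ℝ) (X Y : Fin N → α)
    (σ : Equiv.Perm (Fin N)) :
    pairEnergy N g c X (fun i => Y (σ i)) = pairEnergy N g c X Y := by
  have h1 : ∑ i, ∑ j, g (Y (σ i)) (Y (σ j)) = ∑ i, ∑ j, g (Y i) (Y j) := by
    rw [Equiv.sum_comp σ fun i => ∑ j, g (Y i) (Y (σ j))]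
    exact Finset.sum_congr rfl fun i _ => Equiv.sum_comp σ fun j => g (Y i) (Y j)
  have h2 : ∑ i, ∑ j, g (X i) (Y (σ j)) = ∑ i, ∑ j, g (X i) (Y j) :=
    Finset.sum_congr rfl fun i _ => Equiv.sum_comp σ fun j => g (X i) (Y j)
  simp only [pairEnergy, Finset.sum_add_distrib, Finset.sum_sub_distrib, ← Finset.mul_sum, h1, h2]

theorem pi_withDensity_ofReal {ι α : Type*} [Fintype ι] [MeasurableSpace α] (μ : Measure α)
    [SigmaFinite μ] {f : α → ℝ} (hf : Integrable f μ) (h0 : ∀ x, 0 ≤ f x) :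
    Measure.pi (fun _ : ι => μ.withDensity fun x => ENNReal.ofReal (f x)) =
      (Measure.pi fun _ : ι => μ).withDensity fun x => ENNReal.ofReal (∏ i, f (x i)) := by
  have : IsFiniteMeasure (μ.withDensity fun x => ENNReal.ofReal (f x)) :=
    isFiniteMeasure_withDensity_ofReal hf.2
  refine Measure.pi_eq fun s hs => ?_
  rw [withDensity_apply _ (MeasurableSet.univ_pi hs), Measure.restrict_pi_pi,
    ← ofReal_integral_eq_lintegral_ofReal
      (Integrable.fintype_prod (f := fun _ => f) fun i => hf.restrict)
      (Filter.Eventually.of_forall fun x => Finset.prod_nonneg fun i _ => h0 _),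
    integral_fintype_prod_eq_prod (fun _ => f), ENNReal.ofReal_prod_of_nonneg]
  · refine Finset.prod_congr rfl fun i _ => ?_
    rw [withDensity_apply _ (hs i), ofReal_integral_eq_lintegral_ofReal hf.restrict
      (Filter.Eventually.of_forall h0)]
  · exact fun i _ => integral_nonneg h0

theorem measurePreserving_eval_pair {ι α : Type*} [Fintype ι] [MeasurableSpace α] (P : Measure α)
    [IsProbabilityMeasure P] {i j : ι} (hij : i ≠ j) :
    MeasurePreserving (fun ω : ι → α => (ω i, ω j)) (Measure.pi fun _ => P) (P.prod P) := by
  refine ⟨by fun_prop, ?_⟩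
  have h := ProbabilityTheory.iIndepFun_pi (μ := fun _ : ι => P) (X := fun _ => id)
    fun _ => aemeasurable_id
  have h2 := (ProbabilityTheory.indepFun_iff_map_prod_eq_prod_map_map
    (measurable_pi_apply i).aemeasurable (measurable_pi_apply j).aemeasurable).1
    (h.indepFun hij)
  rw [(measurePreserving_eval (fun _ : ι => P) i).map_eq.symm.symm] at h2
  refine h2.trans ?_
  congr 1
  · exact (measurePreserving_eval (fun _ : ι => P) j).map_eq

theorem exp_mul_le_integral_exp_pair_sum {α : Type*} [MeasurableSpace α] (P : Measure α)
    [IsProbabilityMeasure P] (N : ℕ) {ψ : α → α → ℝ} {m b : ℝ}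
    (hψ : Integrable (fun p : α × α => ψ p.1 p.2) (P.prod P))
    (hψm : Measurable fun p : α × α => ψ p.1 p.2)
    (hψb : ∀ x y, ψ x y ≤ b) (hm : m ≤ ∫ p, ψ p.1 p.2 ∂(P.prod P)) :
    Real.exp (N * (N - 1) * m) ≤
      ∫ ω : Fin N → α, Real.exp (∑ i, ∑ j ∈ Finset.univ.erase i, ψ (ω i) (ω j))
        ∂(Measure.pi fun _ => P) := by
  set f : (Fin N → α) → ℝ := fun ω => ∑ i, ∑ j ∈ Finset.univ.erase i, ψ (ω i) (ω j) with hf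
  have hpair : ∀ i : Fin N, ∀ j ∈ Finset.univ.erase i,
      Integrable (fun ω : Fin N → α => ψ (ω i) (ω j)) (Measure.pi fun _ => P) ∧
      ∫ ω : Fin N → α, ψ (ω i) (ω j) ∂(Measure.pi fun _ => P) =
        ∫ p, ψ p.1 p.2 ∂(P.prod P) := by
    intro i j hj
    have hmp := measurePreserving_eval_pair (ι := Fin N) P (Finset.ne_of_mem_erase hj).symm
    refine ⟨hmp.integrable_comp_of_integrable hψ, ?_⟩
    rw [← hmp.map_eq, integral_map hmp.measurable.aemeasurable hψm.aestronglyMeasurable]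
  have hfi : Integrable f (Measure.pi fun _ => P) :=
    integrable_finsetSum _ fun i _ => integrable_finsetSum _ fun j hj => (hpair i j hj).1
  have hfint : ∫ ω, f ω ∂(Measure.pi fun _ => P) =
      N * (N - 1) * ∫ p, ψ p.1 p.2 ∂(P.prod P) := by
    rw [hf, integral_finsetSum _ fun i _ => integrable_finsetSum _ fun j hj => (hpair i j hj).1]
    have : ∀ i ∈ (Finset.univ : Finset (Fin N)),
        ∫ ω, ∑ j ∈ Finset.univ.erase i, ψ (ω i) (ω j) ∂(Measure.pi fun _ => P) =
          ((N : ℝ) - 1) * ∫ p, ψ p.1 p.2 ∂(P.prod P) := by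
      intro i _
      rw [integral_finsetSum _ fun j hj => (hpair i j hj).1,
        Finset.sum_congr rfl fun j hj => (hpair i j hj).2, Finset.sum_const,
        Finset.card_erase_of_mem (Finset.mem_univ i), Finset.card_univ, Fintype.card_fin,
        nsmul_eq_mul, Nat.cast_sub (by have := i.pos; omega), Nat.cast_one]
    rw [Finset.sum_congr rfl this]
    simp [mul_assoc]
  have hfm : Measurable f := by
    refine Finset.measurable_sum _ fun i _ => Finset.measurable_sum _ fun j _ => ?_
    exact hψm.comp (g := fun p : α × α => ψ p.1 p.2) (f := fun ω : Fin N → α => (ω i, ω j))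
      (by fun_prop)
  have hexp : Integrable (fun ω => Real.exp (f ω)) (Measure.pi fun _ => P) := by
    refine Integrable.of_bound (C := Real.exp (∑ i : Fin N, ∑ j ∈ Finset.univ.erase i, b))
      hfm.exp.aestronglyMeasurable (Filter.Eventually.of_forall fun ω => ?_)
    rw [Real.norm_eq_abs, abs_of_pos (Real.exp_pos _)]
    exact Real.exp_le_exp.2 (Finset.sum_le_sum fun i _ => Finset.sum_le_sum fun j _ => hψb _ _)
  set t : ℝ := ∫ ω, f ω ∂(Measure.pi fun _ => P) with ht
  have hNN : (0 : ℝ) ≤ N * (N - 1) := by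
    rcases Nat.eq_zero_or_pos N with h | h
    · simp [h]
    · have : (1 : ℝ) ≤ N := by exact_mod_cast h
      nlinarith
  calc Real.exp (N * (N - 1) * m) ≤ Real.exp t := by
        rw [hfint]; exact Real.exp_le_exp.2 (mul_le_mul_of_nonneg_left hm hNN)
    _ = ∫ ω, Real.exp t * (1 + (f ω - t)) ∂(Measure.pi fun _ => P) := by
        rw [integral_const_mul, integral_add (g := fun ω => f ω - t) (integrable_const _)
          (hfi.sub (integrable_const _)), integral_sub hfi (integrable_const _)]
        simp [← ht]
    _ ≤ _ := by
        refine integral_mono (((integrable_const _).add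
          (hfi.sub (integrable_const _))).const_mul _) hexp fun ω => ?_
        have h1 := Real.add_one_le_exp (f ω - t)
        have h2 : Real.exp (f ω) = Real.exp t * Real.exp (f ω - t) := by
          rw [← Real.exp_add]; ring_nf
        change _ ≤ Real.exp (f ω)
        rw [h2]
        exact mul_le_mul_of_nonneg_left (by linarith) (Real.exp_pos t).le

/-- The Gibbs law of a single dipole `(x, y)`, restricted to `S` and normalized by `M`. -/
def dipoleLaw {α : Type*} [MeasurableSpace α] (μ : Measure α) (g : α → α → ℝ) (S : Set (α × α))
    (M : ℝ) : Measure (α × α) :=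
  (μ.prod μ).withDensity fun d =>
    ENNReal.ofReal (S.indicator (fun d => Real.exp (g d.1 d.2)) d / M)

theorem dipoleLaw_swap {α : Type*} [MeasurableSpace α] (μ : Measure α) [IsFiniteMeasure μ]
    {g : α → α → ℝ} {S : Set (α × α)} {M : ℝ} (hsymm : ∀ x y, g x y = g y x)
    (hswap : ∀ d, d.swap ∈ S ↔ d ∈ S) :
    MeasurePreserving Prod.swap (dipoleLaw μ g S M) (dipoleLaw μ g S M) := by
  refine ⟨measurable_swap, ?_⟩
  ext s hs
  rw [Measure.map_apply measurable_swap hs, dipoleLaw, withDensity_apply _ hs,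
    withDensity_apply _ (measurable_swap hs)]
  rw [← (Measure.measurePreserving_swap (μ := μ) (ν := μ)).setLIntegral_comp_preimage_emb
    MeasurableEquiv.prodComm.measurableEmbedding]
  refine lintegral_congr fun d => ?_
  by_cases hd : d ∈ S
  · simp [Set.indicator_of_mem, hd, (hswap d).2 hd, hsymm d.2 d.1]
  · simp [Set.indicator_of_notMem, hd, (hswap d).not.2 hd]

theorem integral_dipoleInt_eq_zero {α : Type*} [MeasurableSpace α] (P : Measure (α × α))
    [IsProbabilityMeasure P] (hP : MeasurePreserving Prod.swap P P) {g : α → α → ℝ}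
    (hgm : Measurable fun p : α × α => g p.1 p.2) :
    ∫ p, dipoleInt g p.1 p.2 ∂(P.prod P) = 0 := by
  have hmp := hP.prod (MeasurePreserving.id P)
  have hD : Measurable fun p : (α × α) × (α × α) => dipoleInt g p.1 p.2 := by
    have h : ∀ u v : (α × α) × (α × α) → α, Measurable u → Measurable v →
        Measurable fun p => g (u p) (v p) := fun u v hu hv => hgm.comp (hu.prodMk hv)
    unfold dipoleInt
    exact (((h _ _ (by fun_prop) (by fun_prop)).add (h _ _ (by fun_prop) (by fun_prop))).sub
      (h _ _ (by fun_prop) (by fun_prop))).sub (h _ _ (by fun_prop) (by fun_prop))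
  have h1 : ∫ p, dipoleInt g p.1 p.2 ∂(P.prod P) =
      ∫ p, -dipoleInt g p.1 p.2 ∂(P.prod P) := by
    conv_lhs => rw [← hmp.map_eq]
    rw [integral_map hmp.measurable.aemeasurable hD.aestronglyMeasurable]
    refine integral_congr_ae (Filter.Eventually.of_forall fun p => ?_)
    simp only [dipoleInt, Prod.map_fst, Prod.map_snd, Prod.fst_swap, Prod.snd_swap, id]
    ring
  rw [integral_neg] at h1
  linarith

theorem measurePreserving_comp_perm {ι α : Type*} [Fintype ι] [MeasurableSpace α] (μ : Measure α)
    [IsFiniteMeasure μ] (σ : Equiv.Perm ι) :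
    MeasurePreserving (fun (Y : ι → α) i => Y (σ i)) (Measure.pi fun _ => μ)
      (Measure.pi fun _ => μ) := by
  have h := measurePreserving_piCongrLeft (α := fun _ : ι => α) (fun _ : ι => μ) σ.symm
  convert h using 1
  ext Y i
  rw [MeasurableEquiv.coe_piCongrLeft]
  have := Equiv.piCongrLeft_apply_apply (fun _ : ι => α) σ.symm Y (σ i)
  simpa using this.symm

theorem measurable_pairEnergy {α : Type*} [MeasurableSpace α] (N : ℕ) {g : α → α → ℝ}
    (hgm : Measurable fun p : α × α => g p.1 p.2) (c : ℝ) :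
    Measurable fun p : (Fin N → α) × (Fin N → α) => pairEnergy N g c p.1 p.2 := by
  have h : ∀ u v : (Fin N → α) × (Fin N → α) → α, Measurable u → Measurable v →
      Measurable fun p => g (u p) (v p) := fun u v hu hv => hgm.comp (hu.prodMk hv)
  unfold pairEnergy
  refine ((Finset.measurable_sum _ fun i _ => Finset.measurable_sum _ fun j _ => ?_).const_mul
    _).sub measurable_const
  exact ((h _ _ (by fun_prop) (by fun_prop)).add (h _ _ (by fun_prop) (by fun_prop))).sub
    ((h _ _ (by fun_prop) (by fun_prop)).const_mul _)

theorem abs_pairEnergy_le {α : Type*} (N : ℕ) {g : α → α → ℝ} {B : ℝ}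
    (hB : ∀ x y, |g x y| ≤ B) (c : ℝ) (X Y : Fin N → α) :
    |pairEnergy N g c X Y| ≤ 2 * N * N * B + N * |c| := by
  have h1 : |∑ i, ∑ j, (g (X i) (X j) + g (Y i) (Y j) - 2 * g (X i) (Y j))| ≤
      ∑ _i : Fin N, ∑ _j : Fin N, 4 * B := by
    refine (Finset.abs_sum_le_sum_abs _ _).trans (Finset.sum_le_sum fun i _ => ?_)
    refine (Finset.abs_sum_le_sum_abs _ _).trans (Finset.sum_le_sum fun j _ => ?_)
    have h1 := abs_le.1 (hB (X i) (X j))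
    have h2 := abs_le.1 (hB (Y i) (Y j))
    have h3 := abs_le.1 (hB (X i) (Y j))
    exact abs_le.2 ⟨by linarith, by linarith⟩
  simp only [Finset.sum_const, Finset.card_univ, Fintype.card_fin, nsmul_eq_mul] at h1
  unfold pairEnergy
  refine (abs_sub _ _).trans ?_
  rw [abs_mul, abs_mul, Nat.abs_cast, abs_of_pos (by norm_num : (0 : ℝ) < 1 / 2)]
  linarith

/-- The product over `i` of the probabilities `h (X i) (Y i) / ∑ j, h (X i) (Y j)`. -/
def matchWeight {α : Type*} {N : ℕ} (h : α → α → ℝ) (X Y : Fin N → α) : ℝ :=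
  ∏ i, (h (X i) (Y i) / ∑ j, h (X i) (Y j))

theorem matchWeight_nonneg {α : Type*} {N : ℕ} {h : α → α → ℝ} (hpos : ∀ x y, 0 < h x y)
    (X Y : Fin N → α) : 0 ≤ matchWeight h X Y :=
  Finset.prod_nonneg fun _ _ => div_nonneg (hpos _ _).le
    (Finset.sum_nonneg fun _ _ => (hpos _ _).le)

theorem sum_matchWeight_perm_le_one {α : Type*} {N : ℕ} {h : α → α → ℝ}
    (hpos : ∀ x y, 0 < h x y) (X Y : Fin N → α) :
    ∑ σ : Equiv.Perm (Fin N), matchWeight h X (fun i => Y (σ i)) ≤ 1 := by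
  refine le_trans (le_of_eq ?_) (sum_perm_prod_div_le_one (fun i j => h (X i) (Y j))
    fun i j => hpos _ _)
  refine Finset.sum_congr rfl fun σ _ => Finset.prod_congr rfl fun i _ => ?_
  rw [Equiv.sum_comp σ fun j => h (X i) (Y j)]

theorem matchWeight_le_one {α : Type*} {N : ℕ} {h : α → α → ℝ} (hpos : ∀ x y, 0 < h x y)
    (X Y : Fin N → α) : matchWeight h X Y ≤ 1 := by
  refine le_trans ?_ (sum_matchWeight_perm_le_one hpos X Y)
  exact Finset.single_le_sum (f := fun σ : Equiv.Perm (Fin N) =>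
    matchWeight h X (fun i => Y (σ i))) (fun σ _ => matchWeight_nonneg hpos _ _)
    (Finset.mem_univ (Equiv.refl _))

theorem measurable_matchWeight {α : Type*} [MeasurableSpace α] (N : ℕ) {h : α → α → ℝ}
    (hhm : Measurable fun p : α × α => h p.1 p.2) :
    Measurable fun p : (Fin N → α) × (Fin N → α) => matchWeight h p.1 p.2 := by
  have hm : ∀ u v : (Fin N → α) × (Fin N → α) → α, Measurable u → Measurable v →
      Measurable fun p => h (u p) (v p) := fun u v hu hv => hhm.comp (hu.prodMk hv)
  unfold matchWeight
  refine Finset.measurable_prod _ fun i _ => ?_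
  exact (hm _ _ (by fun_prop) (by fun_prop)).div
    (Finset.measurable_sum _ fun j _ => hm _ _ (by fun_prop) (by fun_prop))

theorem integrable_exp_neg_pairEnergy_mul {α : Type*} [MeasurableSpace α] (μ : Measure α)
    [IsFiniteMeasure μ] (N : ℕ) {g : α → α → ℝ} {B : ℝ} (c : ℝ)
    (hgm : Measurable fun p : α × α => g p.1 p.2) (hB : ∀ x y, |g x y| ≤ B)
    {w : (Fin N → α) × (Fin N → α) → ℝ} (hw : Measurable w) (hw1 : ∀ p, |w p| ≤ 1) :
    Integrable (fun p : (Fin N → α) × (Fin N → α) => Real.exp (-pairEnergy N g c p.1 p.2) * w p)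
      ((Measure.pi fun _ => μ).prod (Measure.pi fun _ => μ)) := by
  refine Integrable.of_bound (C := Real.exp (2 * N * N * B + N * |c|))
    ((measurable_pairEnergy N hgm c).neg.exp.mul hw).aestronglyMeasurable
    (Filter.Eventually.of_forall fun p => ?_)
  rw [Real.norm_eq_abs, abs_mul, abs_of_pos (Real.exp_pos _)]
  have h1 := abs_le.1 (abs_pairEnergy_le N hB c p.1 p.2)
  have h2 : Real.exp (-pairEnergy N g c p.1 p.2) ≤ Real.exp (2 * N * N * B + N * |c|) :=
    Real.exp_le_exp.2 (by linarith)
  nlinarith [hw1 p, abs_nonneg (w p), Real.exp_pos (-pairEnergy N g c p.1 p.2)]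

theorem factorial_mul_integral_matchWeight_le {α : Type*} [MeasurableSpace α] (μ : Measure α)
    [IsFiniteMeasure μ] (N : ℕ) {g h : α → α → ℝ} {B : ℝ} (c : ℝ)
    (hgm : Measurable fun p : α × α => g p.1 p.2) (hB : ∀ x y, |g x y| ≤ B)
    (hhm : Measurable fun p : α × α => h p.1 p.2) (hpos : ∀ x y, 0 < h x y) :
    (N.factorial : ℝ) * ∫ p : (Fin N → α) × (Fin N → α),
        Real.exp (-pairEnergy N g c p.1 p.2) * matchWeight h p.1 p.2
          ∂((Measure.pi fun _ => μ).prod (Measure.pi fun _ => μ)) ≤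
      ∫ p : (Fin N → α) × (Fin N → α), Real.exp (-pairEnergy N g c p.1 p.2)
          ∂((Measure.pi fun _ => μ).prod (Measure.pi fun _ => μ)) := by
  set μμ := (Measure.pi fun _ : Fin N => μ).prod (Measure.pi fun _ : Fin N => μ)
  set G : (Fin N → α) × (Fin N → α) → ℝ := fun p =>
    Real.exp (-pairEnergy N g c p.1 p.2) * matchWeight h p.1 p.2 with hG
  have hGm : Measurable G :=
    (measurable_pairEnergy N hgm c).neg.exp.mul (measurable_matchWeight N hhm)
  have hGi : Integrable G μμ :=
    integrable_exp_neg_pairEnergy_mul μ N c hgm hB (measurable_matchWeight N hhm) fun p => by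
      rw [abs_of_nonneg (matchWeight_nonneg hpos _ _)]; exact matchWeight_le_one hpos _ _
  have hmp : ∀ σ : Equiv.Perm (Fin N),
      MeasurePreserving (Prod.map id fun (Y : Fin N → α) i => Y (σ i)) μμ μμ := fun σ =>
    (MeasurePreserving.id _).prod (measurePreserving_comp_perm μ σ)
  have hσ : ∀ σ : Equiv.Perm (Fin N),
      ∫ p : (Fin N → α) × (Fin N → α), G (p.1, fun i => p.2 (σ i)) ∂μμ = ∫ p, G p ∂μμ := by
    intro σ
    conv_rhs => rw [← (hmp σ).map_eq]
    rw [integral_map (hmp σ).measurable.aemeasurable hGm.aestronglyMeasurable]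
    rfl
  have hσi : ∀ σ : Equiv.Perm (Fin N),
      Integrable (fun p : (Fin N → α) × (Fin N → α) => G (p.1, fun i => p.2 (σ i))) μμ :=
    fun σ => (hmp σ).integrable_comp_of_integrable hGi
  have hsum : (N.factorial : ℝ) * ∫ p, G p ∂μμ = ∫ p : (Fin N → α) × (Fin N → α),
      ∑ σ : Equiv.Perm (Fin N), G (p.1, fun i => p.2 (σ i)) ∂μμ := by
    rw [integral_finsetSum _ fun σ _ => hσi σ, Finset.sum_congr rfl fun σ _ => hσ σ,
      Finset.sum_const, Finset.card_univ, Fintype.card_perm, Fintype.card_fin, nsmul_eq_mul]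
  rw [hsum]
  have hexp := integrable_exp_neg_pairEnergy_mul μ N c hgm hB (w := fun _ => 1)
    measurable_const (by simp)
  simp only [mul_one] at hexp
  refine integral_mono (integrable_finsetSum _ fun σ _ => hσi σ) hexp fun p => ?_
  simp only [hG, pairEnergy_comp_perm, ← Finset.mul_sum]
  exact mul_le_of_le_one_right (Real.exp_pos _).le (sum_matchWeight_perm_le_one hpos _ _)

theorem prod_exp_mul_exp_le {α : Type*} {N : ℕ} {g h : α → α → ℝ} {c : ℝ}
    (hsymm : ∀ x y, g x y = g y x) (hdiag : ∀ x, g x x = c) (hpos : ∀ x y, 0 < h x y)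
    (X Y : Fin N → α) :
    (∏ i, Real.exp (g (X i) (Y i))) * Real.exp (∑ i, ∑ j ∈ Finset.univ.erase i,
        (-(1 / 2) * dipoleInt g (X i, Y i) (X j, Y j) -
          Real.log (1 + h (X i) (Y j) / h (X i) (Y i)))) ≤
      Real.exp (-pairEnergy N g c X Y) * matchWeight h X Y := by
  have h1 := exp_neg_sum_log_le_prod_div (fun i j => h (X i) (Y j)) fun i j => hpos _ _
  refine le_trans (le_of_eq ?_) (mul_le_mul_of_nonneg_left h1 (Real.exp_pos _).le)
  rw [neg_pairEnergy_eq hsymm hdiag, ← Real.exp_sum, ← Real.exp_add, ← Real.exp_add]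
  congr 1
  simp only [Finset.sum_sub_distrib, neg_mul, Finset.sum_neg_distrib]
  ring

theorem partition_lower_bound {α : Type*} [MeasurableSpace α] (μ : Measure α)
    [IsFiniteMeasure μ] (N : ℕ) {g h : α → α → ℝ} {B c e M : ℝ}
    (hgm : Measurable fun p : α × α => g p.1 p.2) (hsymm : ∀ x y, g x y = g y x)
    (hdiag : ∀ x, g x x = c) (hB : ∀ x y, |g x y| ≤ B)
    (hhm : Measurable fun p : α × α => h p.1 p.2) (hpos : ∀ x y, 0 < h x y)
    {S : Set (α × α)} (hS : MeasurableSet S) (hswap : ∀ d : α × α, d.swap ∈ S ↔ d ∈ S)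
    (hM : M = ∫ d in S, Real.exp (g d.1 d.2) ∂(μ.prod μ)) (hM0 : 0 < M) (he : 0 ≤ e)
    (hE : ∫⁻ d, ∫⁻ d', ENNReal.ofReal (Real.log (1 + h d.1 d'.2 / h d.1 d.2))
      ∂(dipoleLaw μ g S M) ∂(dipoleLaw μ g S M) ≤ ENNReal.ofReal e) :
    N.factorial * M ^ N * Real.exp (-(N * (N - 1) * e)) ≤
      ∫ p : (Fin N → α) × (Fin N → α), Real.exp (-pairEnergy N g c p.1 p.2)
          ∂((Measure.pi fun _ => μ).prod (Measure.pi fun _ => μ)) := by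
  set φ : α × α → ℝ := S.indicator (fun d => Real.exp (g d.1 d.2)) with hφ
  have hφm : Measurable φ := hgm.exp.indicator hS
  have hφ0 : ∀ d, 0 ≤ φ d := fun d => Set.indicator_nonneg (fun _ _ => (Real.exp_pos _).le) d
  have hφle : ∀ d, φ d ≤ Real.exp (g d.1 d.2) := fun d =>
    Set.indicator_le_self' (fun _ _ => (Real.exp_pos _).le) d
  have hφi : Integrable φ (μ.prod μ) := by
    refine Integrable.of_bound (C := Real.exp B) hφm.aestronglyMeasurable
      (Filter.Eventually.of_forall fun d => ?_)
    rw [Real.norm_eq_abs, abs_of_nonneg (hφ0 d)]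
    exact (hφle d).trans (Real.exp_le_exp.2 (abs_le.1 (hB _ _)).2)
  have hφM : ∫ d, φ d ∂(μ.prod μ) = M := by rw [hM, hφ, integral_indicator hS]
  set P := dipoleLaw μ g S M with hPdef
  have hPdens : P = (μ.prod μ).withDensity fun d => ENNReal.ofReal (φ d / M) := rfl
  have hP : IsProbabilityMeasure P := by
    refine ⟨?_⟩
    rw [hPdens, withDensity_apply _ MeasurableSet.univ, Measure.restrict_univ,
      ← ofReal_integral_eq_lintegral_ofReal (hφi.div_const M)
        (Filter.Eventually.of_forall fun d => div_nonneg (hφ0 d) hM0.le),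
      integral_div, hφM, div_self hM0.ne', ENNReal.ofReal_one]
  have hgm' : ∀ u v : (α × α) × (α × α) → α, Measurable u → Measurable v →
      Measurable fun p => g (u p) (v p) := fun u v hu hv => hgm.comp (hu.prodMk hv)
  have hhm' : ∀ u v : (α × α) × (α × α) → α, Measurable u → Measurable v →
      Measurable fun p => h (u p) (v p) := fun u v hu hv => hhm.comp (hu.prodMk hv)
  have hDm : Measurable fun p : (α × α) × (α × α) => dipoleInt g p.1 p.2 := by
    unfold dipoleInt
    exact (((hgm' _ _ (by fun_prop) (by fun_prop)).add (hgm' _ _ (by fun_prop)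
      (by fun_prop))).sub (hgm' _ _ (by fun_prop) (by fun_prop))).sub
      (hgm' _ _ (by fun_prop) (by fun_prop))
  have hDb : ∀ d d', |dipoleInt g d d'| ≤ 4 * B := by
    intro d d'
    have h1 := abs_le.1 (hB d.1 d'.1)
    have h2 := abs_le.1 (hB d.2 d'.2)
    have h3 := abs_le.1 (hB d.1 d'.2)
    have h4 := abs_le.1 (hB d.2 d'.1)
    unfold dipoleInt
    exact abs_le.2 ⟨by linarith, by linarith⟩
  have hDi : Integrable (fun p : (α × α) × (α × α) => dipoleInt g p.1 p.2) (P.prod P) :=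
    Integrable.of_bound (C := 4 * B) hDm.aestronglyMeasurable
      (Filter.Eventually.of_forall fun p => hDb _ _)
  set Lg : α × α → α × α → ℝ := fun d d' => Real.log (1 + h d.1 d'.2 / h d.1 d.2) with hLg
  have hL0 : ∀ d d', 0 ≤ Lg d d' := fun d d' =>
    Real.log_nonneg (by have := div_pos (hpos d.1 d'.2) (hpos d.1 d.2); linarith)
  have hLm : Measurable fun p : (α × α) × (α × α) => Lg p.1 p.2 :=
    (measurable_const.add ((hhm' _ _ (by fun_prop) (by fun_prop)).div
      (hhm' _ _ (by fun_prop) (by fun_prop)))).log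
  have hLlint : ∫⁻ p, ENNReal.ofReal (Lg p.1 p.2) ∂(P.prod P) ≤ ENNReal.ofReal e := by
    rw [lintegral_prod _ hLm.ennreal_ofReal.aemeasurable]
    exact hE
  have hLi : Integrable (fun p : (α × α) × (α × α) => Lg p.1 p.2) (P.prod P) := by
    refine ⟨hLm.aestronglyMeasurable, ?_⟩
    rw [hasFiniteIntegral_iff_ofReal (Filter.Eventually.of_forall fun p => hL0 _ _)]
    exact hLlint.trans_lt ENNReal.ofReal_lt_top
  have hLint : ∫ p, Lg p.1 p.2 ∂(P.prod P) ≤ e := by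
    rw [integral_eq_lintegral_of_nonneg_ae (Filter.Eventually.of_forall fun p => hL0 _ _)
      hLm.aestronglyMeasurable]
    exact ENNReal.toReal_le_of_le_ofReal he hLlint
  have key := exp_mul_le_integral_exp_pair_sum P N
    (ψ := fun d d' => -(1 / 2) * dipoleInt g d d' - Lg d d') (m := -e) (b := 2 * B)
    ((hDi.const_mul _).sub hLi) ((hDm.const_mul _).sub hLm)
    (fun d d' => by have := (abs_le.1 (hDb d d')).1; have := hL0 d d'; linarith)
    (by
      rw [integral_sub (hDi.const_mul _) hLi, integral_const_mul,
        integral_dipoleInt_eq_zero P (dipoleLaw_swap μ hsymm hswap) hgm]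
      linarith)
  refine le_trans ?_ (factorial_mul_integral_matchWeight_le μ N c hgm hB hhm hpos)
  rw [mul_assoc]
  refine mul_le_mul_of_nonneg_left ?_ (Nat.cast_nonneg _)
  rw [mul_neg] at key
  refine (mul_le_mul_of_nonneg_left key (pow_nonneg hM0.le N)).trans ?_
  have hmp := measurePreserving_arrowProdEquivProdArrow α α (Fin N) (fun _ => μ) (fun _ => μ)
  have hGi := integrable_exp_neg_pairEnergy_mul μ N c hgm hB (measurable_matchWeight N hhm)
    fun p => by
      rw [abs_of_nonneg (matchWeight_nonneg hpos _ _)]; exact matchWeight_le_one hpos _ _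
  have hdens : Measurable fun ω : Fin N → α × α => ENNReal.ofReal (∏ i, φ (ω i) / M) :=
    (Finset.measurable_prod _ fun i _ =>
      (hφm.comp (measurable_pi_apply i)).div_const M).ennreal_ofReal
  rw [← hmp.map_eq, integral_map_equiv, hPdens, pi_withDensity_ofReal _ (hφi.div_const M)
      (fun d => div_nonneg (hφ0 d) hM0.le),
    integral_withDensity_eq_integral_toReal_smul
      hdens
      (Filter.Eventually.of_forall fun _ => ENNReal.ofReal_lt_top),
    ← integral_const_mul]
  refine integral_mono_of_nonneg (Filter.Eventually.of_forall fun ω => ?_)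
    (hmp.integrable_comp_of_integrable hGi) (Filter.Eventually.of_forall fun ω => ?_)
  · exact mul_nonneg (pow_nonneg hM0.le N)
      (mul_nonneg ENNReal.toReal_nonneg (Real.exp_pos _).le)
  · dsimp only
    rw [ENNReal.toReal_ofReal (Finset.prod_nonneg fun i _ => div_nonneg (hφ0 _) hM0.le),
      Finset.prod_div_distrib, Finset.prod_const, Finset.card_univ, Fintype.card_fin, smul_eq_mul,
      ← mul_assoc, mul_div_cancel₀ _ (pow_pos hM0 N).ne']
    refine le_trans (mul_le_mul_of_nonneg_right
      (Finset.prod_le_prod (fun i _ => hφ0 _) fun i _ => hφle _) (Real.exp_pos _).le) ?_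
    exact prod_exp_mul_exp_le hsymm hdiag hpos (fun i => (ω i).1) (fun i => (ω i).2)

theorem volume_closedBall_unit : volume (Metric.closedBall (0 : E2) 1) = ENNReal.ofReal π := by
  rw [EuclideanSpace.volume_closedBall_fin_two]
  simp [ENNReal.ofReal, Real.toNNReal_of_nonneg pi_pos.le]

theorem integrable_comp_norm_iff (f : ℝ → ℝ) :
    Integrable (fun x : E2 => f ‖x‖) ↔ IntegrableOn (fun t => t * f t) (Set.Ioi 0) := by
  have h := integrable_fun_norm_addHaar (volume : Measure E2) (f := f)
  simpa using h

theorem integral_comp_norm (f : ℝ → ℝ) :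
    ∫ x : E2, f ‖x‖ = 2 * π * ∫ t in Set.Ioi (0 : ℝ), t * f t := by
  have h := integral_fun_norm_addHaar (volume : Measure E2) f
  have hv : volume.real (Metric.ball (0 : E2) 1) = π := by
    rw [measureReal_def, ← Measure.addHaar_closedBall_eq_addHaar_ball, volume_closedBall_unit,
      ENNReal.toReal_ofReal pi_pos.le]
  rw [h, hv]
  simp [mul_assoc]

/-- The truncated inverse, a bound for the positive part of `-log`. -/
def truncInv (t : ℝ) : ℝ := if t ≤ 1 then t⁻¹ else 0

theorem integrable_truncInv_norm : Integrable fun x : E2 => truncInv ‖x‖ := by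
  rw [integrable_comp_norm_iff]
  have h : IntegrableOn (fun _ : ℝ => (1 : ℝ)) (Set.Ioc 0 1) := integrableOn_const (by simp)
  have h2 : IntegrableOn ((Set.Ioc (0 : ℝ) 1).indicator fun _ => (1 : ℝ)) (Set.Ioi 0) :=
    (h.integrable_indicator measurableSet_Ioc).integrableOn
  refine h2.congr_fun (fun t ht => ?_) measurableSet_Ioi
  have ht0 : 0 < t := ht
  by_cases h1 : t ≤ 1
  · simp [truncInv, h1, ht0, ht0.ne']
  · simp [truncInv, h1]

theorem truncInv_nonneg {t : ℝ} (ht : 0 ≤ t) : 0 ≤ truncInv t := by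
  unfold truncInv; split_ifs <;> positivity

theorem gfun_le_truncInv (u : E2) : gfun u ≤ truncInv ‖u‖ := by
  unfold gfun truncInv
  rcases (norm_nonneg u).eq_or_lt' with h | h
  · simp [h]
  split_ifs with h1
  · have := Real.one_sub_inv_le_log_of_pos h
    linarith
  · have := Real.log_nonneg (not_le.1 h1).le
    linarith

theorem abs_gfun_le (u : E2) : |gfun u| ≤ truncInv ‖u‖ + ‖u‖ := by
  have h1 := gfun_le_truncInv u
  have h2 : Real.log ‖u‖ ≤ ‖u‖ := Real.log_le_self (norm_nonneg u)
  have h3 := truncInv_nonneg (norm_nonneg u)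
  refine abs_le.2 ⟨?_, by linarith [norm_nonneg u]⟩
  unfold gfun; linarith

theorem measurable_gfun : Measurable gfun := by unfold gfun; fun_prop

theorem isProbabilityMeasure_udisc (z : E2) {lam : ℝ} (h : 0 < lam) :
    IsProbabilityMeasure (udisc z lam) := by
  refine ⟨?_⟩
  rw [udisc, Measure.smul_apply, Measure.restrict_apply_univ, smul_eq_mul]
  exact ENNReal.inv_mul_cancel (Metric.measure_closedBall_pos volume z h).ne'
    measure_closedBall_lt_top.ne

instance : IsProbabilityMeasure (udisc 0 1) := isProbabilityMeasure_udisc 0 one_pos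

theorem udisc_eq_map (z : E2) {lam : ℝ} (h : 0 < lam) :
    udisc z lam = (udisc 0 1).map fun y => z + lam • y := by
  have hf : Measurable fun y : E2 => z + lam • y := by fun_prop
  have hvol : ∀ s : Set E2, volume ((fun y : E2 => z + lam • y) ⁻¹' s) =
      ENNReal.ofReal |(lam ^ 2)⁻¹| * volume s := by
    intro s
    have h1 : (fun y : E2 => z + lam • y) ⁻¹' s = (lam • ·) ⁻¹' ((z + ·) ⁻¹' s) := rfl
    rw [h1, Measure.addHaar_preimage_smul volume h.ne', measure_preimage_add]
    simp
  have hball : (fun y : E2 => z + lam • y) ⁻¹' Metric.closedBall z lam =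
      Metric.closedBall 0 1 := by
    ext y
    simp [norm_smul, abs_of_pos h, h]
  have hc : ENNReal.ofReal |(lam ^ 2)⁻¹| ≠ 0 := by
    have : 0 < |(lam ^ 2)⁻¹| := by positivity
    simpa using h.ne'
  ext s hs
  rw [Measure.map_apply hf hs, udisc, udisc, Measure.smul_apply, Measure.smul_apply,
    Measure.restrict_apply hs, Measure.restrict_apply (hf hs), ← hball, ← Set.preimage_inter,
    hvol, hvol, smul_eq_mul, smul_eq_mul, ENNReal.mul_inv (Or.inl hc)
    (Or.inl ENNReal.ofReal_ne_top), mul_mul_mul_comm, ENNReal.inv_mul_cancel hc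
    ENNReal.ofReal_ne_top, one_mul]

theorem integrable_comp_sub_udisc {f : E2 → ℝ} (hf : Integrable f) (w : E2) :
    Integrable (fun y => f (w - y)) (udisc 0 1) := by
  refine ((hf.comp_sub_left w).restrict (s := Metric.closedBall 0 1)).smul_measure ?_
  exact ENNReal.inv_ne_top.2 (Metric.measure_closedBall_pos volume _ one_pos).ne'

theorem ae_norm_le_one_udisc : ∀ᵐ y ∂(udisc 0 1), ‖y‖ ≤ 1 := by
  refine Measure.ae_smul_measure ?_ _
  filter_upwards [ae_restrict_mem Metric.isClosed_closedBall.measurableSet] with y hy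
  simpa using hy

theorem ae_ne_udisc (w : E2) : ∀ᵐ y ∂(udisc 0 1), y ≠ w := by
  refine Measure.ae_smul_measure ?_ _
  exact ae_restrict_of_ae (Measure.ae_ne volume w)

theorem integral_truncInv_le : ∃ c, 0 ≤ c ∧ ∀ w : E2,
    ∫ y, truncInv ‖w - y‖ ∂(udisc 0 1) ≤ c := by
  refine ⟨(volume (Metric.closedBall (0 : E2) 1))⁻¹.toReal * ∫ x : E2, truncInv ‖x‖,
    mul_nonneg ENNReal.toReal_nonneg (integral_nonneg fun x => truncInv_nonneg (norm_nonneg x)),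
    fun w => ?_⟩
  rw [udisc, integral_smul_measure, smul_eq_mul]
  refine mul_le_mul_of_nonneg_left ?_ ENNReal.toReal_nonneg
  rw [← integral_sub_left_eq_self (fun x : E2 => truncInv ‖x‖) volume w]
  exact setIntegral_le_integral (integrable_truncInv_norm.comp_sub_left w)
    (Filter.Eventually.of_forall fun x => truncInv_nonneg (norm_nonneg _))

/-- The logarithmic potential of the uniform measure on the unit disc. -/
def discPot (w : E2) : ℝ := ∫ y, gfun (w - y) ∂(udisc 0 1)

theorem measurable_discPot : Measurable discPot := by
  have h : StronglyMeasurable fun p : E2 × E2 => gfun (p.1 - p.2) :=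
    (measurable_gfun.comp (by fun_prop)).stronglyMeasurable
  exact h.integral_prod_right.measurable

theorem integrable_norm_sub_udisc (w : E2) : Integrable (fun y => ‖w - y‖) (udisc 0 1) := by
  refine Integrable.of_bound (C := ‖w‖ + 1) (by fun_prop) ?_
  filter_upwards [ae_norm_le_one_udisc] with y hy
  rw [norm_norm]
  exact (norm_sub_le _ _).trans (by linarith)

theorem integrable_gfun_sub_udisc (w : E2) : Integrable (fun y => gfun (w - y)) (udisc 0 1) := by
  refine ((integrable_comp_sub_udisc integrable_truncInv_norm w).add
    (integrable_norm_sub_udisc w)).mono'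
    (measurable_gfun.comp (by fun_prop)).aestronglyMeasurable
    (Filter.Eventually.of_forall fun y => ?_)
  exact abs_gfun_le _

theorem discPot_bounds : ∃ c, 0 ≤ c ∧ ∀ w, discPot w ≤ c ∧ |discPot w| ≤ c + 1 + ‖w‖ := by
  obtain ⟨c, hc0, hc⟩ := integral_truncInv_le
  have hT := fun w => integrable_comp_sub_udisc integrable_truncInv_norm w
  refine ⟨c, hc0, fun w => ⟨?_, ?_⟩⟩
  · refine le_trans ?_ (hc w)
    exact integral_mono (integrable_gfun_sub_udisc w) (hT w) fun y => gfun_le_truncInv _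
  · refine (abs_integral_le_integral_abs).trans ?_
    have h1 : ∫ y, |gfun (w - y)| ∂(udisc 0 1) ≤
        ∫ y, (truncInv ‖w - y‖ + ‖w - y‖) ∂(udisc 0 1) :=
      integral_mono (integrable_gfun_sub_udisc w).abs ((hT w).add (integrable_norm_sub_udisc w))
        fun y => abs_gfun_le _
    rw [integral_add (hT w) (integrable_norm_sub_udisc w)] at h1
    have h2 : ∫ y, ‖w - y‖ ∂(udisc 0 1) ≤ ∫ _y, (‖w‖ + 1) ∂(udisc 0 1) := by
      refine integral_mono_ae (integrable_norm_sub_udisc w) (integrable_const _) ?_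
      filter_upwards [ae_norm_le_one_udisc] with y hy
      exact (norm_sub_le _ _).trans (by linarith)
    rw [integral_const] at h2
    simp at h2
    linarith [hc w]

theorem discPot_le_of_two_le {w : E2} (hw : 2 ≤ ‖w‖) : discPot w ≤ -Real.log (‖w‖ - 1) := by
  have h : discPot w ≤ ∫ _y, -Real.log (‖w‖ - 1) ∂(udisc 0 1) := by
    refine integral_mono_ae (integrable_gfun_sub_udisc w) (integrable_const _) ?_
    filter_upwards [ae_norm_le_one_udisc] with y hy
    have h1 : ‖w‖ - 1 ≤ ‖w - y‖ := by linarith [norm_sub_norm_le w y]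
    have h2 := Real.log_le_log (by linarith) h1
    unfold gfun
    linarith
  simpa using h

theorem integrable_discPot_sub (z : E2) : Integrable (fun x => discPot (x - z)) (udisc 0 1) := by
  obtain ⟨c, hc0, hc⟩ := discPot_bounds
  refine Integrable.of_bound (C := c + 1 + (1 + ‖z‖))
    (measurable_discPot.comp (by fun_prop)).aestronglyMeasurable ?_
  filter_upwards [ae_norm_le_one_udisc] with x hx
  have := (hc (x - z)).2
  have h2 := norm_sub_le x z
  rw [Real.norm_eq_abs]
  linarith

theorem gsm_eq {lam : ℝ} (h : 0 < lam) (z : E2) :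
    gsm lam z = (∫ x, discPot (x - lam⁻¹ • z) ∂(udisc 0 1)) - Real.log lam := by
  have hin : ∀ x, ∫ y, gfun (x - y) ∂(udisc z lam) =
      discPot (lam⁻¹ • x - lam⁻¹ • z) - Real.log lam := by
    intro x
    have hg : Measurable fun y => gfun (x - y) := measurable_gfun.comp (by fun_prop)
    rw [udisc_eq_map z h, integral_map (by fun_prop) hg.aestronglyMeasurable, discPot]
    have h1 : (fun y => gfun (x - (z + lam • y))) =ᵐ[udisc 0 1]
        fun y => gfun (lam⁻¹ • x - lam⁻¹ • z - y) - Real.log lam := by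
      filter_upwards [ae_ne_udisc (lam⁻¹ • x - lam⁻¹ • z)] with y hy
      have h2 : x - (z + lam • y) = lam • (lam⁻¹ • x - lam⁻¹ • z - y) := by
        rw [smul_sub, smul_sub, smul_inv_smul₀ h.ne', smul_inv_smul₀ h.ne']; abel
      have h3 : ‖lam⁻¹ • x - lam⁻¹ • z - y‖ ≠ 0 := by
        rw [norm_ne_zero_iff, sub_ne_zero]; exact hy.symm
      rw [gfun, gfun, h2, norm_smul, Real.norm_eq_abs, abs_of_pos h, Real.log_mul h.ne' h3]
      ring
    rw [integral_congr_ae h1, integral_sub (integrable_gfun_sub_udisc _) (integrable_const _)]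
    simp
  have hm : Measurable fun x : E2 => discPot (lam⁻¹ • x - lam⁻¹ • z) - Real.log lam :=
    (measurable_discPot.comp (by fun_prop)).sub_const _
  rw [gsm]
  simp only [hin]
  rw [udisc_eq_map 0 h, integral_map (by fun_prop) hm.aestronglyMeasurable]
  have h4 : ∀ x : E2, lam⁻¹ • (0 + lam • x) = x := fun x => by
    rw [zero_add, inv_smul_smul₀ h.ne']
  simp only [h4]
  rw [integral_sub (integrable_discPot_sub _) (integrable_const _)]
  simp

theorem gsm_one_eq (z : E2) : gsm 1 z = ∫ x, discPot (x - z) ∂(udisc 0 1) := by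
  simpa using gsm_eq one_pos z

theorem gsm_eq_gsm_one {lam : ℝ} (h : 0 < lam) (z : E2) :
    gsm lam z = gsm 1 (lam⁻¹ • z) - Real.log lam := by rw [gsm_eq h, gsm_one_eq]

theorem measurable_gsm_one : Measurable (gsm 1) := by
  have h1 : Measurable (Function.uncurry fun z x : E2 => discPot (x - z)) :=
    measurable_discPot.comp (measurable_snd.sub measurable_fst)
  have h := h1.stronglyMeasurable
  have h2 := h.integral_prod_right (ν := udisc 0 1)
  rw [show gsm 1 = fun z => ∫ x, discPot (x - z) ∂(udisc 0 1) from funext gsm_one_eq]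
  exact h2.measurable

theorem udisc_map_isometry (T : E2 ≃ₗᵢ[ℝ] E2) : (udisc 0 1).map T = udisc 0 1 := by
  ext s hs
  have hT := T.measurePreserving
  have hb : T ⁻¹' Metric.closedBall 0 1 = Metric.closedBall 0 1 := by ext x; simp
  rw [Measure.map_apply hT.measurable hs, udisc, Measure.smul_apply, Measure.smul_apply,
    Measure.restrict_apply hs, Measure.restrict_apply (hT.measurable hs)]
  conv_lhs => rw [← hb]
  rw [← Set.preimage_inter, hT.measure_preimage
    (hs.inter Metric.isClosed_closedBall.measurableSet).nullMeasurableSet, hb]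

theorem discPot_isometry (T : E2 ≃ₗᵢ[ℝ] E2) (w : E2) : discPot (T w) = discPot w := by
  have hm : Measurable fun y => gfun (T w - y) := measurable_gfun.comp (by fun_prop)
  rw [discPot, ← udisc_map_isometry T, integral_map T.continuous.measurable.aemeasurable
    hm.aestronglyMeasurable]
  simp only [← map_sub, gfun, T.norm_map]
  rfl

theorem gsm_one_isometry (T : E2 ≃ₗᵢ[ℝ] E2) (z : E2) : gsm 1 (T z) = gsm 1 z := by
  rw [gsm_one_eq, gsm_one_eq]
  have hm : Measurable fun x => discPot (x - T z) := measurable_discPot.comp (by fun_prop)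
  conv_lhs => rw [← udisc_map_isometry T]
  rw [integral_map T.continuous.measurable.aemeasurable hm.aestronglyMeasurable]
  simp only [← map_sub, discPot_isometry]

theorem gsm_one_eq_of_norm_eq {v w : E2} (h : ‖v‖ = ‖w‖) : gsm 1 v = gsm 1 w := by
  have h1 := Submodule.reflection_sub h
  rw [← h1, gsm_one_isometry]

theorem g1rad_norm (v : E2) : g1rad ‖v‖ = gsm 1 v :=
  gsm_one_eq_of_norm_eq (by simp)

theorem abs_gsm_one_le : ∃ c, 0 ≤ c ∧ ∀ v, |gsm 1 v| ≤ c + ‖v‖ := by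
  obtain ⟨c, hc0, hc⟩ := discPot_bounds
  refine ⟨c + 2, by linarith, fun v => ?_⟩
  rw [gsm_one_eq]
  refine abs_integral_le_integral_abs.trans ?_
  have h : ∫ x, |discPot (x - v)| ∂(udisc 0 1) ≤ ∫ _x, (c + 2 + ‖v‖) ∂(udisc 0 1) := by
    refine integral_mono_ae (integrable_discPot_sub v).abs (integrable_const _) ?_
    filter_upwards [ae_norm_le_one_udisc] with x hx
    have h1 := (hc (x - v)).2
    have h2 := norm_sub_le x v
    linarith
  simpa using h

theorem exp_gsm_one_le : ∃ A, 0 < A ∧ ∀ v, Real.exp (gsm 1 v) ≤ A * (1 + ‖v‖)⁻¹ := by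
  obtain ⟨c, hc0, hc⟩ := discPot_bounds
  refine ⟨5 * Real.exp c, by positivity, fun v => ?_⟩
  have h1v : 0 < 1 + ‖v‖ := by positivity
  rw [← div_eq_mul_inv, le_div_iff₀ h1v]
  have hec : 1 ≤ Real.exp c := Real.one_le_exp hc0
  rcases le_total ‖v‖ 4 with hv | hv
  · have h : gsm 1 v ≤ ∫ _x, c ∂(udisc 0 1) := by
      rw [gsm_one_eq]
      exact integral_mono (integrable_discPot_sub v) (integrable_const _) fun x => (hc _).1
    simp only [integral_const, probReal_univ, one_smul] at h
    nlinarith [Real.exp_le_exp.2 h, Real.exp_pos (gsm 1 v)]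
  · have h : gsm 1 v ≤ ∫ _x, -Real.log (‖v‖ - 2) ∂(udisc 0 1) := by
      rw [gsm_one_eq]
      refine integral_mono_ae (integrable_discPot_sub v) (integrable_const _) ?_
      filter_upwards [ae_norm_le_one_udisc] with x hx
      have h1 : ‖v‖ - 1 ≤ ‖x - v‖ := by linarith [norm_sub_norm_le v x, norm_sub_rev x v]
      have h2 := discPot_le_of_two_le (w := x - v) (by linarith)
      have h3 := Real.log_le_log (x := ‖v‖ - 2) (by linarith) (by linarith : _ ≤ ‖x - v‖ - 1)
      linarith
    simp only [integral_const, probReal_univ, one_smul] at h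
    have h2 := Real.exp_le_exp.2 h
    rw [Real.exp_neg, Real.exp_log (by linarith)] at h2
    have h3 : (‖v‖ - 2)⁻¹ * (1 + ‖v‖) ≤ 5 := by
      rw [inv_mul_le_iff₀ (by linarith)]; linarith
    nlinarith

theorem integrable_one_add_norm_rpow {s : ℝ} (hs : 0 < s) :
    Integrable fun v : E2 => (1 + ‖v‖) ^ (-(2 + s)) :=
  integrable_one_add_norm (by simpa using hs)

theorem integral_one_add_norm_rpow_le {s : ℝ} (hs : 0 < s) :
    ∫ v : E2, (1 + ‖v‖) ^ (-(2 + s)) ≤ 2 * π * s⁻¹ := by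
  rw [integral_comp_norm fun t => (1 + t) ^ (-(2 + s))]
  refine mul_le_mul_of_nonneg_left ?_ (by positivity)
  have hd : ∀ x ∈ Set.Ici (0 : ℝ), HasDerivAt (fun t : ℝ => -s⁻¹ * (1 + t) ^ (-s))
      ((1 + x) ^ (-1 - s)) x := by
    intro x hx
    have hx0 : (0 : ℝ) ≤ x := hx
    have h1 := ((hasDerivAt_id x).const_add 1).rpow_const (p := -s)
      (Or.inl (by simp only [id]; positivity))
    refine (h1.const_mul (-s⁻¹)).congr_deriv ?_
    rw [show -s - 1 = -1 - s by ring, id]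
    field_simp
  have ht : Filter.Tendsto (fun t : ℝ => -s⁻¹ * (1 + t) ^ (-s)) Filter.atTop (nhds 0) := by
    have h := ((tendsto_rpow_neg_atTop hs).comp
      (Filter.tendsto_atTop_add_const_left Filter.atTop (1 : ℝ) Filter.tendsto_id)).const_mul (-s⁻¹)
    simpa using h
  have hp : ∀ x ∈ Set.Ioi (0 : ℝ), 0 ≤ (1 + x) ^ (-1 - s) := fun x hx => by
    have : (0 : ℝ) < x := hx
    positivity
  have hi := integral_Ioi_of_hasDerivAt_of_nonneg' hd hp ht
  have hint := integrableOn_Ioi_deriv_of_nonneg' hd hp ht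
  have hle : ∫ t in Set.Ioi (0 : ℝ), t * (1 + t) ^ (-(2 + s)) ≤
      ∫ t in Set.Ioi (0 : ℝ), (1 + t) ^ (-1 - s) := by
    refine integral_mono_of_nonneg ?_ hint ?_
    · filter_upwards [ae_restrict_mem measurableSet_Ioi] with t ht
      have : (0 : ℝ) < t := ht
      simp only [Pi.zero_apply]
      positivity
    · filter_upwards [ae_restrict_mem measurableSet_Ioi] with t ht
      have ht0 : (0 : ℝ) < t := ht
      rw [show -1 - s = 1 + -(2 + s) by ring, rpow_add (by positivity), rpow_one]
      gcongr
      linarith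
  rw [hi] at hle
  simpa using hle

theorem exp_mul_gsm_one_le : ∀ β : ℝ, 0 ≤ β → ∃ A, 0 < A ∧
    ∀ v, Real.exp (β * gsm 1 v) ≤ A * (1 + ‖v‖) ^ (-β) := by
  intro β hβ
  obtain ⟨A, hA, h⟩ := exp_gsm_one_le
  refine ⟨A ^ β, by positivity, fun v => ?_⟩
  rw [mul_comm, Real.exp_mul]
  refine (rpow_le_rpow (Real.exp_pos _).le (h v) hβ).trans_eq ?_
  rw [mul_rpow hA.le (by positivity), inv_rpow (by positivity), rpow_neg (by positivity)]

theorem measurable_exp_mul_gsm_one (β : ℝ) : Measurable fun v => Real.exp (β * gsm 1 v) :=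
  Real.measurable_exp.comp (measurable_gsm_one.const_mul β)

theorem integrable_exp_mul_gsm_one {β : ℝ} (hβ : 2 < β) :
    Integrable fun v => Real.exp (β * gsm 1 v) := by
  obtain ⟨A, hA, h⟩ := exp_mul_gsm_one_le β (by linarith)
  have hi := (integrable_one_add_norm_rpow (s := β - 2) (by linarith)).const_mul A
  rw [show -(2 + (β - 2)) = -β by ring] at hi
  refine hi.mono' (measurable_exp_mul_gsm_one β).aestronglyMeasurable
    (Filter.Eventually.of_forall fun v => ?_)
  rw [Real.norm_eq_abs, Real.abs_exp]
  exact h v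

theorem integral_exp_mul_gsm_one {β : ℝ} (hβ : 2 < β) :
    ∫ v, Real.exp (β * gsm 1 v) = Zbeta β := by
  simp_rw [← g1rad_norm]
  rw [integral_comp_norm fun t => Real.exp (β * g1rad t), Zbeta, if_neg hβ.ne']
  simp_rw [mul_comm]

theorem Zbeta_pos {β : ℝ} (hβ : 2 < β) : 0 < Zbeta β := by
  rw [← integral_exp_mul_gsm_one hβ]
  exact integral_exp_pos (integrable_exp_mul_gsm_one hβ)

/-- The mass of the dipole law outside the unit scale plus its second moment inside. -/
def tailMoment (β lam : ℝ) : ℝ :=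
  ∫ v : E2, min 1 ((lam * ‖v‖) ^ 2) * Real.exp (β * gsm 1 v)

theorem min_one_sq_nonneg (x : ℝ) : 0 ≤ min 1 (x ^ 2) := le_min zero_le_one (sq_nonneg x)

theorem min_one_sq_le_rpow {x q : ℝ} (hx : 0 ≤ x) (hq : 0 ≤ q) (hq2 : q ≤ 2) :
    min 1 (x ^ 2) ≤ x ^ q := by
  rcases le_total x 1 with h | h
  · refine (min_le_right _ _).trans ?_
    rcases hx.eq_or_lt with rfl | h0
    · simp only [ne_eq, OfNat.ofNat_ne_zero, not_false_eq_true, zero_pow]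
      positivity
    · rw [← rpow_natCast]
      exact rpow_le_rpow_of_exponent_ge h0 h (by simpa using hq2)
  · exact (min_le_left _ _).trans (one_le_rpow h hq)

theorem integrable_tailMoment {β : ℝ} (hβ : 2 < β) (lam : ℝ) :
    Integrable fun v : E2 => min 1 ((lam * ‖v‖) ^ 2) * Real.exp (β * gsm 1 v) := by
  refine (integrable_exp_mul_gsm_one hβ).mono'
    (Measurable.mul (by fun_prop) (measurable_exp_mul_gsm_one β)).aestronglyMeasurable
    (Filter.Eventually.of_forall fun v => ?_)
  rw [norm_mul, Real.norm_eq_abs, Real.norm_eq_abs, Real.abs_exp,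
    abs_of_nonneg (min_one_sq_nonneg _)]
  exact mul_le_of_le_one_left (Real.exp_pos _).le (min_le_left _ _)

theorem tailMoment_nonneg (β lam : ℝ) : 0 ≤ tailMoment β lam :=
  integral_nonneg fun _ => mul_nonneg (min_one_sq_nonneg _) (Real.exp_pos _).le

theorem tailMoment_le_rpow {β : ℝ} (hβ : 2 < β) : ∃ A, 0 < A ∧ ∀ lam q : ℝ, 0 < lam → 0 ≤ q →
    q ≤ 2 → q < β - 2 → tailMoment β lam ≤ A * lam ^ q * (β - 2 - q)⁻¹ := by
  obtain ⟨A, hA, h⟩ := exp_mul_gsm_one_le β (by linarith)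
  refine ⟨A * (2 * π), by positivity, fun lam q hl hq hq2 hqβ => ?_⟩
  have hs : 0 < β - 2 - q := by linarith
  have hi := integrable_one_add_norm_rpow hs
  have h1 : tailMoment β lam ≤ ∫ v : E2, A * lam ^ q * (1 + ‖v‖) ^ (-(2 + (β - 2 - q))) := by
    refine integral_mono (integrable_tailMoment hβ lam) (hi.const_mul _) fun v => ?_
    have h2 := min_one_sq_le_rpow (x := lam * ‖v‖) (by positivity) hq hq2
    have h3 : (lam * ‖v‖) ^ q ≤ lam ^ q * (1 + ‖v‖) ^ q := by
      rw [mul_rpow hl.le (norm_nonneg v)]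
      gcongr
      linarith
    calc min 1 ((lam * ‖v‖) ^ 2) * Real.exp (β * gsm 1 v)
        ≤ (lam ^ q * (1 + ‖v‖) ^ q) * (A * (1 + ‖v‖) ^ (-β)) := by
          gcongr
          · exact h2.trans h3
          · exact h v
      _ = A * lam ^ q * (1 + ‖v‖) ^ (-(2 + (β - 2 - q))) := by
          rw [show -(2 + (β - 2 - q)) = q + -β by ring, rpow_add (by positivity)]
          ring
  rw [integral_const_mul] at h1
  refine h1.trans ?_
  have h4 := mul_le_mul_of_nonneg_left (integral_one_add_norm_rpow_le hs)
    (by positivity : 0 ≤ A * lam ^ q)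
  linarith

theorem integrable_min_one_sq_mul_rpow {β : ℝ} (hβ : 2 < β) (hβ4 : β < 4) :
    Integrable fun v : E2 => min 1 (‖v‖ ^ 2) * ‖v‖ ^ (-β) := by
  rw [integrable_comp_norm_iff fun t => min 1 (t ^ 2) * t ^ (-β),
    ← Set.Ioc_union_Ioi_eq_Ioi zero_le_one]
  refine IntegrableOn.union ?_ ?_
  · have h := (intervalIntegral.intervalIntegrable_rpow' (a := 0) (b := 1) (r := 3 - β)
      (by linarith)).1
    refine h.congr_fun (fun t ht => ?_) measurableSet_Ioc
    have h1 : t ^ 2 ≤ 1 := pow_le_one₀ ht.1.le ht.2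
    simp only [min_eq_right h1]
    rw [show 3 - β = (3 : ℕ) + -β by norm_num; ring, rpow_add ht.1, rpow_natCast]
    ring
  · have h := integrableOn_Ioi_rpow_of_lt (a := 1 - β) (by linarith) one_pos
    refine h.congr_fun (fun t ht => ?_) measurableSet_Ioi
    have h0 : (1 : ℝ) < t := ht
    have h1 : 1 ≤ t ^ 2 := one_le_pow₀ h0.le
    simp only [min_eq_left h1]
    rw [show 1 - β = 1 + -β by ring, rpow_add (by linarith), rpow_one]
    ring

theorem tailMoment_le_of_lt_four {β : ℝ} (hβ : 2 < β) (hβ4 : β < 4) : ∃ A, 0 < A ∧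
    ∀ lam : ℝ, 0 < lam → tailMoment β lam ≤ A * lam ^ (β - 2) := by
  obtain ⟨A, hA, h⟩ := exp_mul_gsm_one_le β (by linarith)
  have hi := integrable_min_one_sq_mul_rpow hβ hβ4
  have hI : 0 ≤ ∫ v : E2, min 1 (‖v‖ ^ 2) * ‖v‖ ^ (-β) := integral_nonneg fun v =>
    mul_nonneg (min_one_sq_nonneg _) (by positivity)
  refine ⟨A * ((∫ v : E2, min 1 (‖v‖ ^ 2) * ‖v‖ ^ (-β)) + 1), by positivity, fun lam hl => ?_⟩
  have h1 : tailMoment β lam ≤ ∫ v : E2, A * lam ^ β *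
      (min 1 (‖lam • v‖ ^ 2) * ‖lam • v‖ ^ (-β)) := by
    refine integral_mono_ae (integrable_tailMoment hβ lam)
      ((hi.comp_smul hl.ne').const_mul _) ?_
    filter_upwards [Measure.ae_ne volume (0 : E2)] with v hv
    have hv0 : 0 < ‖v‖ := norm_pos_iff.2 hv
    have h2 : (1 + ‖v‖) ^ (-β) ≤ ‖v‖ ^ (-β) :=
      rpow_le_rpow_of_nonpos hv0 (by linarith) (by linarith)
    rw [norm_smul, Real.norm_eq_abs, abs_of_pos hl, mul_rpow hl.le hv0.le]
    have h3 : lam ^ β * lam ^ (-β) = 1 := by rw [← rpow_add hl]; simp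
    calc min 1 ((lam * ‖v‖) ^ 2) * Real.exp (β * gsm 1 v)
        ≤ min 1 ((lam * ‖v‖) ^ 2) * (A * ‖v‖ ^ (-β)) := by
          refine mul_le_mul_of_nonneg_left ((h v).trans ?_) (min_one_sq_nonneg _)
          gcongr
      _ = A * (lam ^ β * lam ^ (-β)) * (min 1 ((lam * ‖v‖) ^ 2) * ‖v‖ ^ (-β)) := by
          rw [h3]; ring
      _ = _ := by ring
  rw [integral_const_mul, Measure.integral_comp_smul volume
    (fun v : E2 => min 1 (‖v‖ ^ 2) * ‖v‖ ^ (-β))] at h1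
  simp only [finrank_euclideanSpace, Fintype.card_fin, smul_eq_mul] at h1
  rw [abs_of_pos (by positivity), ← mul_assoc, mul_assoc A,
    show lam ^ β * (lam ^ 2)⁻¹ = lam ^ (β - 2) by
      rw [rpow_sub hl, ← div_eq_mul_inv]; norm_num] at h1
  refine h1.trans ?_
  have : 0 ≤ A * lam ^ (β - 2) := by positivity
  nlinarith

theorem tendsto_tailMoment {β : ℝ} (hβ : 2 < β) {η : ℝ} (hη : 0 < η) :
    ∃ lam0, 0 < lam0 ∧ ∀ lam, 0 < lam → lam < lam0 → tailMoment β lam ≤ η := by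
  obtain ⟨A, hA, h⟩ := tailMoment_le_rpow hβ
  set q := min 2 ((β - 2) / 2) with hq
  have hq0 : 0 < q := lt_min two_pos (by linarith)
  have hqβ : q < β - 2 := (min_le_right _ _).trans_lt (by linarith)
  have hs : 0 < β - 2 - q := by linarith
  have ht : Filter.Tendsto (fun lam : ℝ => A * lam ^ q * (β - 2 - q)⁻¹) (nhds 0) (nhds 0) := by
    have h1 := (((continuous_id.rpow_const fun _ => Or.inr hq0.le).tendsto (0 : ℝ)).const_mul
      A).mul_const (β - 2 - q)⁻¹
    simpa [hq0.ne'] using h1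
  obtain ⟨d, hd, hd2⟩ := Metric.eventually_nhds_iff.1 (ht.eventually (gt_mem_nhds hη))
  refine ⟨d, hd, fun lam h0 h1 => (h lam q h0 hq0.le (min_le_left _ _) hqβ).trans (hd2 ?_).le⟩
  simpa [abs_of_pos h0] using h1

/-- The rate at which the dipole approximation of the free energy converges. -/
def dipoleRate (β lam : ℝ) : ℝ :=
  (if β < 4 then lam ^ (β - 2) else 0) + (if β = 4 then lam ^ 2 * |Real.log lam| ^ 2 else 0) +
    (if 4 < β then lam ^ 2 * |Real.log lam| else 0)

theorem one_le_abs_log {lam : ℝ} (h0 : 0 < lam) (h1 : lam ≤ 1 / 4) : 1 ≤ |Real.log lam| := by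
  have h2 := Real.log_le_log h0 h1
  have h3 : Real.log (1 / 4) = -(2 * Real.log 2) := by
    rw [one_div, Real.log_inv, show (4 : ℝ) = 2 ^ 2 by norm_num, Real.log_pow]; norm_num
  have h4 := Real.log_two_gt_d9
  exact le_abs.2 (Or.inr (by linarith))

theorem sq_add_tailMoment_le {β : ℝ} (hβ : 2 < β) : ∃ C, 0 < C ∧ ∀ lam : ℝ, 0 < lam →
    lam ≤ 1 / 4 → lam ^ 2 + tailMoment β lam ≤ C * dipoleRate β lam := by
  obtain ⟨A, hA, h⟩ := tailMoment_le_rpow hβ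
  rcases lt_trichotomy β 4 with h4 | h4 | h4
  · obtain ⟨B, hB, h'⟩ := tailMoment_le_of_lt_four hβ h4
    refine ⟨1 + B, by positivity, fun lam h0 h1 => ?_⟩
    have h2 : lam ^ 2 ≤ lam ^ (β - 2) := by
      rw [← rpow_natCast]
      exact rpow_le_rpow_of_exponent_ge h0 (by linarith) (by norm_num; linarith)
    simp only [dipoleRate, h4, h4.ne, not_lt.2 h4.le, if_true, if_false, add_zero]
    linarith [h' lam h0]
  · subst h4
    refine ⟨1 + A * Real.exp 1, by positivity, fun lam h0 h1 => ?_⟩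
    have hl := one_le_abs_log h0 h1
    set s := |Real.log lam|⁻¹ with hs
    have hs0 : 0 < s := by positivity
    have hs1 : s ≤ 1 := inv_le_one_of_one_le₀ hl
    have h2 := h lam (2 - s) h0 (by linarith) (by linarith) (by linarith)
    have h3 : lam ^ (2 - s) = lam ^ 2 * Real.exp 1 := by
      rw [sub_eq_add_neg, rpow_add h0, rpow_def_of_pos h0 (-s)]
      have : Real.log lam * -s = 1 := by
        have hneg : Real.log lam < 0 := Real.log_neg h0 (by linarith)
        rw [hs, abs_of_neg hneg]
        have := hneg.ne
        field_simp
      rw [this]; norm_num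
    rw [h3, show (4 : ℝ) - 2 - (2 - s) = s by ring, hs, inv_inv] at h2
    simp only [dipoleRate, lt_irrefl, if_true, if_false, add_zero, zero_add]
    have h5 : |Real.log lam| ≤ |Real.log lam| ^ 2 := by nlinarith
    have h6 : A * (lam ^ 2 * Real.exp 1) * |Real.log lam| ≤
        A * (lam ^ 2 * Real.exp 1) * |Real.log lam| ^ 2 := by gcongr
    have h7 : lam ^ 2 * 1 ≤ lam ^ 2 * |Real.log lam| ^ 2 := by gcongr; linarith
    linarith
  · have hs : 0 < β - 4 := by linarith
    refine ⟨1 + A * (β - 4)⁻¹, by positivity, fun lam h0 h1 => ?_⟩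
    have hl := one_le_abs_log h0 h1
    have h2 := h lam 2 h0 (by norm_num) le_rfl (by linarith)
    rw [show β - 2 - 2 = β - 4 by ring, show lam ^ (2 : ℝ) = lam ^ 2 by norm_num] at h2
    simp only [dipoleRate, h4, h4.ne', not_lt.2 h4.le, if_true, if_false, zero_add]
    have h7 : (1 + A * (β - 4)⁻¹) * (lam ^ 2 * 1) ≤
        (1 + A * (β - 4)⁻¹) * (lam ^ 2 * |Real.log lam|) := by gcongr
    linarith

theorem log_one_add_inv_pow_four_le {t : ℝ} (ht : 0 < t) :
    t * Real.log (1 + (t⁻¹) ^ 4) ≤ 8 * (1 + t ^ 2)⁻¹ := by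
  have hs : 0 < t⁻¹ := inv_pos.2 ht
  rw [← div_eq_mul_inv, le_div_iff₀ (by positivity)]
  rcases le_total t 1 with h | h
  · have h1 : Real.log (1 + (t⁻¹) ^ 4) ≤ 4 * t⁻¹ := by
      have h2 : 1 + (t⁻¹) ^ 4 ≤ (1 + t⁻¹) ^ 4 := by
        nlinarith [pow_pos hs 2, pow_pos hs 3]
      refine (Real.log_le_log (by positivity) h2).trans ?_
      rw [Real.log_pow]
      have := Real.log_le_sub_one_of_pos (x := 1 + t⁻¹) (by positivity)
      push_cast
      linarith
    have h3 : t * Real.log (1 + (t⁻¹) ^ 4) ≤ 4 := by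
      refine (mul_le_mul_of_nonneg_left h1 ht.le).trans_eq ?_
      field_simp
    nlinarith
  · have h1 : Real.log (1 + (t⁻¹) ^ 4) ≤ (t⁻¹) ^ 4 := by
      have := Real.log_le_sub_one_of_pos (x := 1 + (t⁻¹) ^ 4) (by positivity)
      linarith
    have h3 : t * Real.log (1 + (t⁻¹) ^ 4) ≤ (t⁻¹) ^ 3 := by
      refine (mul_le_mul_of_nonneg_left h1 ht.le).trans_eq ?_
      field_simp
    have h4 : t⁻¹ ≤ 1 := inv_le_one_of_one_le₀ h
    have h5 : (t⁻¹) ^ 3 * (1 + t ^ 2) = (t⁻¹) ^ 3 + t⁻¹ := by field_simp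
    have h6 : (t⁻¹) ^ 3 ≤ 1 := pow_le_one₀ hs.le h4
    nlinarith [mul_le_mul_of_nonneg_right h3 (by positivity : 0 ≤ 1 + t ^ 2)]

theorem integrable_log_one_add_inv_pow_four :
    Integrable fun u : E2 => Real.log (1 + (‖u‖⁻¹) ^ 4) := by
  rw [integrable_comp_norm_iff fun t => Real.log (1 + (t⁻¹) ^ 4)]
  refine (integrable_inv_one_add_sq.const_mul 8).integrableOn.mono'
    (by fun_prop : Measurable _).aestronglyMeasurable ?_
  filter_upwards [ae_restrict_mem measurableSet_Ioi] with t ht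
  have ht0 : (0 : ℝ) < t := ht
  have h1 : 0 ≤ Real.log (1 + (t⁻¹) ^ 4) := Real.log_nonneg (by
    have : 0 ≤ (t⁻¹) ^ 4 := by positivity
    linarith)
  rw [Real.norm_of_nonneg (by positivity)]
  exact log_one_add_inv_pow_four_le ht0

theorem lintegral_log_one_add_le : ∃ C, 0 < C ∧ ∀ (lam ρ : ℝ) (x : E2), 0 < lam → 0 < ρ →
    ∫⁻ y : E2, ENNReal.ofReal (Real.log (1 + ((lam + ‖x - y‖) ^ 4)⁻¹ / (ρ ^ 4)⁻¹)) ≤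
      ENNReal.ofReal (C * ρ ^ 2) := by
  have hi := integrable_log_one_add_inv_pow_four
  have hnn : ∀ u : E2, 0 ≤ Real.log (1 + (‖u‖⁻¹) ^ 4) := fun u => Real.log_nonneg (by
    have : 0 ≤ (‖u‖⁻¹) ^ 4 := by positivity
    linarith)
  have hI : 0 ≤ ∫ u : E2, Real.log (1 + (‖u‖⁻¹) ^ 4) := integral_nonneg hnn
  refine ⟨(∫ u : E2, Real.log (1 + (‖u‖⁻¹) ^ 4)) + 1, by positivity, fun lam ρ x hl hρ => ?_⟩
  have hi2 := (hi.comp_smul (inv_pos.2 hρ).ne').comp_sub_left x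
  calc ∫⁻ y : E2, ENNReal.ofReal (Real.log (1 + ((lam + ‖x - y‖) ^ 4)⁻¹ / (ρ ^ 4)⁻¹))
      ≤ ∫⁻ y : E2, ENNReal.ofReal (Real.log (1 + (‖ρ⁻¹ • (x - y)‖⁻¹) ^ 4)) := by
        refine lintegral_mono_ae ?_
        filter_upwards [Measure.ae_ne volume x] with y hy
        have h0 : 0 < ‖x - y‖ := norm_pos_iff.2 (sub_ne_zero.2 hy.symm)
        refine ENNReal.ofReal_le_ofReal (Real.log_le_log (by positivity) ?_)
        rw [norm_smul, Real.norm_eq_abs, abs_of_pos (inv_pos.2 hρ), mul_inv, inv_inv, mul_pow,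
          div_inv_eq_mul, mul_comm, inv_pow]
        gcongr
        linarith
    _ = ENNReal.ofReal (∫ y : E2, Real.log (1 + (‖ρ⁻¹ • (x - y)‖⁻¹) ^ 4)) :=
        (ofReal_integral_eq_lintegral_ofReal hi2
          (Filter.Eventually.of_forall fun y => hnn _)).symm
    _ ≤ _ := by
        refine ENNReal.ofReal_le_ofReal ?_
        rw [integral_sub_left_eq_self (fun u : E2 => Real.log (1 + (‖ρ⁻¹ • u‖⁻¹) ^ 4)) volume x,
          Measure.integral_comp_smul volume (fun u : E2 => Real.log (1 + (‖u‖⁻¹) ^ 4))]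
        simp only [finrank_euclideanSpace, Fintype.card_fin, smul_eq_mul, inv_pow, inv_inv]
        rw [abs_of_nonneg (by positivity)]
        simp only [inv_pow] at hI ⊢
        nlinarith [pow_pos hρ 2]

theorem volume_coordinate_box (a b : Fin 2 → ℝ) :
    volume {x : E2 | ∀ i, x i ∈ Set.Icc (a i) (b i)} =
      ENNReal.ofReal (b 0 - a 0) * ENNReal.ofReal (b 1 - a 1) := by
  have h : {x : E2 | ∀ i, x i ∈ Set.Icc (a i) (b i)} =
      (WithLp.ofLp) ⁻¹' (Set.univ.pi fun i => Set.Icc (a i) (b i)) := by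
    ext x; exact ⟨fun h i _ => h i, fun h i => h i trivial⟩
  rw [h, (PiLp.volume_preserving_ofLp (Fin 2)).measure_preimage
    (MeasurableSet.univ_pi fun i => measurableSet_Icc).nullMeasurableSet, volume_pi_pi]
  simp

theorem measurableSet_LamBox (N : ℕ) : MeasurableSet (LamBox N) := by
  have h : LamBox N = ⋂ i : Fin 2, (fun x : E2 => x i) ⁻¹' Set.Icc 0 (Real.sqrt N) := by
    ext x; simp [LamBox]
  rw [h]
  exact MeasurableSet.iInter fun i => measurableSet_Icc.preimage (by fun_prop)

theorem volume_LamBox (N : ℕ) : volume (LamBox N) = ENNReal.ofReal N := by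
  rw [LamBox, volume_coordinate_box (fun _ => 0) fun _ => Real.sqrt N,
    ← ENNReal.ofReal_mul (by simp)]
  simp

instance (N : ℕ) : IsFiniteMeasure (volume.restrict (LamBox N)) :=
  ⟨by rw [Measure.restrict_apply_univ, volume_LamBox]; exact ENNReal.ofReal_lt_top⟩

theorem norm_sub_le_of_mem_LamBox {N : ℕ} {x y : E2} (hx : x ∈ LamBox N) (hy : y ∈ LamBox N) :
    ‖x - y‖ ≤ 2 * Real.sqrt N := by
  have h : ∀ i, ((x - y) i) ^ 2 ≤ Real.sqrt N ^ 2 := fun i => by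
    refine sq_le_sq' ?_ ?_ <;> simp only [PiLp.sub_apply] <;>
      linarith [(hx i).1, (hx i).2, (hy i).1, (hy i).2]
  rw [EuclideanSpace.norm_eq, Real.sqrt_le_left (by positivity)]
  simp only [Real.norm_eq_abs, sq_abs, Fin.sum_univ_two]
  nlinarith [h 0, h 1, sq_nonneg (Real.sqrt N)]

theorem le_volume_LamBox_inter {N : ℕ} (hN : 1 ≤ N) {u : E2} (hu : ‖u‖ ≤ 1) :
    ENNReal.ofReal (N - 2 * Real.sqrt N * ‖u‖) ≤
      volume (LamBox N ∩ {x | x - u ∈ LamBox N}) := by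
  have h : LamBox N ∩ {x | x - u ∈ LamBox N} = {x : E2 | ∀ i, x i ∈
      Set.Icc (max 0 (u i)) (min (Real.sqrt N) (Real.sqrt N + u i))} := by
    ext x
    simp only [LamBox, Set.mem_inter_iff, Set.mem_ofPred_eq, Set.mem_Icc, PiLp.sub_apply,
      sup_le_iff, le_inf_iff, ← forall_and]
    refine forall_congr' fun i => ⟨fun h => ?_, fun h => ?_⟩ <;>
      refine ⟨⟨?_, ?_⟩, ?_, ?_⟩ <;> linarith [h.1.1, h.1.2, h.2.1, h.2.2]
  have hlen : ∀ i, Real.sqrt N - |u i| ≤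
      min (Real.sqrt N) (Real.sqrt N + u i) - max 0 (u i) := fun i => by
    rcases le_total 0 (u i) with h0 | h0
    · rw [abs_of_nonneg h0, max_eq_right h0, min_eq_left (by linarith)]
    · rw [abs_of_nonpos h0, max_eq_left h0, min_eq_right (by linarith)]; linarith
  have hs1 : 1 ≤ Real.sqrt N := Real.one_le_sqrt.2 (by exact_mod_cast hN)
  have hun : ∀ i, |u i| ≤ ‖u‖ := fun i => by
    simpa using PiLp.norm_apply_le u i
  have hnn : ∀ i, 0 ≤ Real.sqrt N - |u i| := fun i => by linarith [hun i]
  rw [h, volume_coordinate_box, ← ENNReal.ofReal_mul ((hnn 0).trans (hlen 0))]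
  refine ENNReal.ofReal_le_ofReal ?_
  refine le_trans ?_ (mul_le_mul (hlen 0) (hlen 1) (hnn 1) ((hnn 0).trans (hlen 0)))
  have hsq : Real.sqrt N * Real.sqrt N = N := Real.mul_self_sqrt (Nat.cast_nonneg N)
  have h2 := mul_le_mul_of_nonneg_left (hun 0) (Real.sqrt_nonneg N)
  have h3 := mul_le_mul_of_nonneg_left (hun 1) (Real.sqrt_nonneg N)
  nlinarith [mul_nonneg (abs_nonneg (u 0)) (abs_nonneg (u 1))]

theorem lintegral_lintegral_sub {Λ : Set E2} (hΛ : MeasurableSet Λ) {f : E2 → ℝ≥0∞}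
    (hf : Measurable f) : ∫⁻ x in Λ, ∫⁻ y in Λ, f (x - y) =
      ∫⁻ u, f u * volume (Λ ∩ {x | x - u ∈ Λ}) := by
  have h1 : ∀ x, ∫⁻ y in Λ, f (x - y) = ∫⁻ u, Λ.indicator 1 (x - u) * f u := by
    intro x
    rw [← lintegral_indicator hΛ, ← lintegral_sub_left_eq_self _ x]
    refine lintegral_congr fun y => ?_
    by_cases hy : x - y ∈ Λ <;> simp [hy]
  have hi : Measurable (Λ.indicator (1 : E2 → ℝ≥0∞)) := measurable_one.indicator hΛ
  have hm : Measurable (Function.uncurry fun x u : E2 => Λ.indicator 1 (x - u) * f u) :=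
    (hi.comp (measurable_fst.sub measurable_snd)).mul (hf.comp measurable_snd)
  simp_rw [h1]
  rw [lintegral_lintegral_swap hm.aemeasurable]
  refine lintegral_congr fun u => ?_
  have hiu : Measurable fun x : E2 => Λ.indicator (1 : E2 → ℝ≥0∞) (x - u) :=
    hi.comp (measurable_id.sub_const u)
  rw [lintegral_mul_const _ hiu, mul_comm]
  congr 1
  have hΛu : MeasurableSet {x | x - u ∈ Λ} := hΛ.preimage (measurable_id.sub_const u)
  rw [show (fun x : E2 => Λ.indicator (1 : E2 → ℝ≥0∞) (x - u)) =
    Set.indicator {x | x - u ∈ Λ} 1 from rfl, lintegral_indicator_one hΛu,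
    Measure.restrict_apply hΛu, Set.inter_comm]

theorem lintegral_lintegral_sub_le {Λ : Set E2} (hΛ : MeasurableSet Λ) {f : E2 → ℝ≥0∞}
    (hf : Measurable f) : ∫⁻ x in Λ, ∫⁻ y in Λ, f (x - y) ≤ volume Λ * ∫⁻ u, f u := by
  rw [lintegral_lintegral_sub hΛ hf, ← lintegral_const_mul _ hf]
  refine lintegral_mono fun u => ?_
  rw [mul_comm]
  gcongr
  exact Set.inter_subset_left

theorem ofReal_integral_le_lintegral {α : Type*} [MeasurableSpace α] {μ : Measure α} {f : α → ℝ}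
    (hf : Integrable f μ) : ENNReal.ofReal (∫ x, f x ∂μ) ≤ ∫⁻ x, ENNReal.ofReal (f x) ∂μ := by
  have h : ∫ x, f x ∂μ ≤ ∫ x, max (f x) 0 ∂μ :=
    integral_mono hf hf.pos_part fun x => le_max_left _ _
  refine (ENNReal.ofReal_le_ofReal h).trans_eq ?_
  rw [ofReal_integral_eq_lintegral_ofReal hf.pos_part
    (Filter.Eventually.of_forall fun x => le_max_right _ _)]
  refine lintegral_congr fun x => ?_
  rcases le_total 0 (f x) with h | h
  · rw [max_eq_left h]
  · rw [max_eq_right h, ENNReal.ofReal_of_nonpos h, ENNReal.ofReal_zero]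

theorem measurable_gsm {lam : ℝ} (hl : 0 < lam) : Measurable (gsm lam) := by
  rw [show gsm lam = fun z => gsm 1 (lam⁻¹ • z) - Real.log lam from
    funext (gsm_eq_gsm_one hl)]
  exact (measurable_gsm_one.comp (measurable_const_smul _)).sub_const _

theorem gsm_neg {lam : ℝ} (hl : 0 < lam) (z : E2) : gsm lam (-z) = gsm lam z := by
  rw [gsm_eq_gsm_one hl, gsm_eq_gsm_one hl]
  congr 1
  exact gsm_one_eq_of_norm_eq (by simp)

theorem exp_mul_gsm {lam : ℝ} (hl : 0 < lam) (β : ℝ) (u : E2) :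
    Real.exp (β * gsm lam u) = lam ^ (-β) * Real.exp (β * gsm 1 (lam⁻¹ • u)) := by
  rw [gsm_eq_gsm_one hl, rpow_def_of_pos hl, ← Real.exp_add]
  congr 1
  ring

theorem integral_mul_exp_gsm {lam : ℝ} (hl : 0 < lam) (β : ℝ) (φ : ℝ → ℝ) :
    ∫ u : E2, φ ‖u‖ * Real.exp (β * gsm lam u) =
      lam ^ (2 - β) * ∫ v : E2, φ (lam * ‖v‖) * Real.exp (β * gsm 1 v) := by
  have h := Measure.integral_comp_smul (volume : Measure E2)
    (fun v => φ (lam * ‖v‖) * Real.exp (β * gsm 1 v)) lam⁻¹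
  have h2 : ∀ u : E2, φ ‖u‖ * Real.exp (β * gsm lam u) =
      lam ^ (-β) * (φ (lam * ‖lam⁻¹ • u‖) * Real.exp (β * gsm 1 (lam⁻¹ • u))) := fun u => by
    rw [exp_mul_gsm hl, norm_smul, Real.norm_eq_abs, abs_of_pos (inv_pos.2 hl),
      mul_inv_cancel_left₀ hl.ne']
    ring
  simp_rw [h2]
  rw [integral_const_mul, h]
  simp only [finrank_euclideanSpace, Fintype.card_fin, smul_eq_mul, inv_pow, inv_inv]
  rw [abs_of_nonneg (by positivity), ← mul_assoc, sub_eq_add_neg, rpow_add hl, rpow_two]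
  ring

theorem integrable_exp_gsm {lam β : ℝ} (hl : 0 < lam) (hβ : 2 < β) :
    Integrable fun u : E2 => Real.exp (β * gsm lam u) := by
  simp_rw [exp_mul_gsm hl]
  exact ((integrable_exp_mul_gsm_one hβ).comp_smul (inv_pos.2 hl).ne').const_mul _

theorem integral_exp_gsm {lam β : ℝ} (hl : 0 < lam) (hβ : 2 < β) :
    ∫ u : E2, Real.exp (β * gsm lam u) = lam ^ (2 - β) * Zbeta β := by
  have h := integral_mul_exp_gsm hl β fun _ => 1
  simp only [one_mul] at h
  rw [h, integral_exp_mul_gsm_one hβ]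

theorem integrable_min_one_sq_mul_exp_gsm {lam β : ℝ} (hl : 0 < lam) (hβ : 2 < β) :
    Integrable fun u : E2 => min 1 (‖u‖ ^ 2) * Real.exp (β * gsm lam u) := by
  refine (integrable_exp_gsm hl hβ).mono' (Measurable.mul (by fun_prop)
    (Real.measurable_exp.comp ((measurable_gsm hl).const_mul β))).aestronglyMeasurable
    (Filter.Eventually.of_forall fun v => ?_)
  rw [norm_mul, Real.norm_eq_abs, Real.norm_eq_abs, Real.abs_exp,
    abs_of_nonneg (min_one_sq_nonneg _)]
  exact mul_le_of_le_one_left (Real.exp_pos _).le (min_le_left _ _)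

theorem integral_min_one_sq_mul_exp_gsm {lam : ℝ} (hl : 0 < lam) (β : ℝ) :
    ∫ u : E2, min 1 (‖u‖ ^ 2) * Real.exp (β * gsm lam u) = lam ^ (2 - β) * tailMoment β lam :=
  integral_mul_exp_gsm hl β fun t => min 1 (t ^ 2)

/-- The interaction `β g_lam(x - y)`, set to zero at distances exceeding the diameter of the box. -/
def cutKernel (N : ℕ) (β lam : ℝ) (x y : E2) : ℝ :=
  if ‖x - y‖ ≤ 2 * Real.sqrt N then β * gsm lam (x - y) else 0

theorem measurable_cutKernel (N : ℕ) (β : ℝ) {lam : ℝ} (hl : 0 < lam) :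
    Measurable fun p : E2 × E2 => cutKernel N β lam p.1 p.2 :=
  Measurable.ite (measurableSet_le (by fun_prop) (by fun_prop))
    (((measurable_gsm hl).comp (measurable_fst.sub measurable_snd)).const_mul β)
    measurable_const

theorem cutKernel_symm (N : ℕ) (β : ℝ) {lam : ℝ} (hl : 0 < lam) (x y : E2) :
    cutKernel N β lam x y = cutKernel N β lam y x := by
  rw [cutKernel, cutKernel, norm_sub_rev, ← neg_sub y x, gsm_neg hl]

theorem cutKernel_self (N : ℕ) (β : ℝ) {lam : ℝ} (hl : 0 < lam) (x : E2) :
    cutKernel N β lam x x = β * (-Real.log lam + kappa) := by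
  rw [cutKernel, sub_self, norm_zero, if_pos (by positivity), gsm_eq_gsm_one hl, smul_zero, kappa]
  ring

theorem cutKernel_of_mem {N : ℕ} (β lam : ℝ) {x y : E2} (hx : x ∈ LamBox N) (hy : y ∈ LamBox N) :
    cutKernel N β lam x y = β * gsm lam (x - y) := if_pos (norm_sub_le_of_mem_LamBox hx hy)

theorem exists_abs_cutKernel_le (N : ℕ) (β : ℝ) {lam : ℝ} (hl : 0 < lam) :
    ∃ B, ∀ x y, |cutKernel N β lam x y| ≤ B := by
  obtain ⟨c, hc0, hc⟩ := abs_gsm_one_le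
  refine ⟨|β| * (c + lam⁻¹ * (2 * Real.sqrt N) + |Real.log lam|), fun x y => ?_⟩
  unfold cutKernel
  split_ifs with h
  · rw [abs_mul, gsm_eq_gsm_one hl]
    gcongr
    refine (abs_sub _ _).trans ?_
    gcongr
    refine (hc _).trans ?_
    rw [norm_smul, Real.norm_eq_abs, abs_of_pos (inv_pos.2 hl)]
    gcongr
  · rw [abs_zero]; positivity

/-- The pairs of points at distance at most one. -/
def nearPairs : Set (E2 × E2) := {d | ‖d.1 - d.2‖ ≤ 1}

theorem measurableSet_nearPairs : MeasurableSet nearPairs :=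
  measurableSet_le (by fun_prop) measurable_const

/-- The partition function of a single dipole of size at most one in the box. -/
def dipoleMass (N : ℕ) (β lam : ℝ) : ℝ :=
  ∫ d in nearPairs, Real.exp (cutKernel N β lam d.1 d.2)
    ∂((volume.restrict (LamBox N)).prod (volume.restrict (LamBox N)))

theorem dipoleMass_nonneg (N : ℕ) (β lam : ℝ) : 0 ≤ dipoleMass N β lam :=
  integral_nonneg fun _ => (Real.exp_pos _).le

theorem lintegral_dipoleLaw_le {N : ℕ} {β lam M : ℝ} (hl : 0 < lam)
    {f F : E2 × E2 → ℝ≥0∞} (hf : Measurable f)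
    (hF : ∀ d ∈ nearPairs, ENNReal.ofReal (Real.exp (β * gsm lam (d.1 - d.2)) / M) * f d ≤ F d) :
    ∫⁻ d, f d ∂(dipoleLaw (volume.restrict (LamBox N)) (cutKernel N β lam) nearPairs M) ≤
      ∫⁻ x in LamBox N, ∫⁻ y in LamBox N, F (x, y) := by
  have hw : Measurable fun d : E2 × E2 => ENNReal.ofReal
      (nearPairs.indicator (fun d => Real.exp (cutKernel N β lam d.1 d.2)) d / M) :=
    (((Real.measurable_exp.comp (measurable_cutKernel N β hl)).indicator
      measurableSet_nearPairs).div_const M).ennreal_ofReal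
  rw [dipoleLaw, lintegral_withDensity_eq_lintegral_mul _ hw hf,
    lintegral_prod _ (hw.mul hf).aemeasurable]
  refine setLIntegral_mono' (measurableSet_LamBox N) fun x hx =>
    setLIntegral_mono' (measurableSet_LamBox N) fun y hy => ?_
  by_cases hd : (x, y) ∈ nearPairs
  · simpa [hd, cutKernel_of_mem β lam hx hy] using hF _ hd
  · simp [hd]

theorem le_dipoleMass {N : ℕ} (hN : 1 ≤ N) {β lam : ℝ} (hβ : 2 < β) (hl : 0 < lam) :
    lam ^ (2 - β) * ((N - 1 / 8) * Zbeta β - 8 * N * tailMoment β lam) ≤ dipoleMass N β lam := by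
  obtain ⟨B, hB⟩ := exists_abs_cutKernel_le N β hl
  have hm : Measurable fun d : E2 × E2 => Real.exp (cutKernel N β lam d.1 d.2) :=
    Real.measurable_exp.comp (measurable_cutKernel N β hl)
  have hint : Integrable (fun d : E2 × E2 => Real.exp (cutKernel N β lam d.1 d.2))
      ((volume.restrict (LamBox N)).prod (volume.restrict (LamBox N))) := by
    refine Integrable.of_bound (C := Real.exp B) hm.aestronglyMeasurable
      (Filter.Eventually.of_forall fun d => ?_)
    rw [Real.norm_eq_abs, Real.abs_exp]
    exact Real.exp_le_exp.2 ((le_abs_self _).trans (hB _ _))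
  have hi1 := integrable_exp_gsm hl hβ
  have hi2 := integrable_min_one_sq_mul_exp_gsm hl hβ
  have hi3 : Integrable fun u : E2 => (N - 1 / 8) * Real.exp (β * gsm lam u) -
      8 * N * (min 1 (‖u‖ ^ 2) * Real.exp (β * gsm lam u)) :=
    (hi1.const_mul _).sub (hi2.const_mul _)
  have hlow : lam ^ (2 - β) * ((N - 1 / 8) * Zbeta β - 8 * N * tailMoment β lam) =
      ∫ u : E2, ((N - 1 / 8) * Real.exp (β * gsm lam u) -
        8 * N * (min 1 (‖u‖ ^ 2) * Real.exp (β * gsm lam u))) := by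
    rw [integral_sub (hi1.const_mul _) (hi2.const_mul _), integral_const_mul, integral_const_mul,
      integral_exp_gsm hl hβ, integral_min_one_sq_mul_exp_gsm hl]
    ring
  have hmeas : Measurable fun u : E2 =>
      if ‖u‖ ≤ 1 then ENNReal.ofReal (Real.exp (β * gsm lam u)) else 0 :=
    Measurable.ite (measurableSet_le (by fun_prop) measurable_const)
      (Real.measurable_exp.comp ((measurable_gsm hl).const_mul β)).ennreal_ofReal
      measurable_const
  have hmass : ENNReal.ofReal (dipoleMass N β lam) = ∫⁻ x in LamBox N, ∫⁻ y in LamBox N,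
      (fun u : E2 => if ‖u‖ ≤ 1 then ENNReal.ofReal (Real.exp (β * gsm lam u)) else 0)
        (x - y) := by
    rw [dipoleMass, ofReal_integral_eq_lintegral_ofReal hint.integrableOn
      (Filter.Eventually.of_forall fun d => (Real.exp_pos _).le),
      ← lintegral_indicator measurableSet_nearPairs,
      lintegral_prod _ (hm.ennreal_ofReal.indicator measurableSet_nearPairs).aemeasurable]
    refine setLIntegral_congr_fun (measurableSet_LamBox N) fun x hx =>
      setLIntegral_congr_fun (measurableSet_LamBox N) fun y hy => ?_
    simp only [Set.indicator_apply, nearPairs, Set.mem_ofPred_eq, cutKernel_of_mem β lam hx hy]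
  rw [← ENNReal.ofReal_le_ofReal_iff (dipoleMass_nonneg N β lam), hmass,
    lintegral_lintegral_sub (measurableSet_LamBox N) hmeas, hlow]
  refine (ofReal_integral_le_lintegral hi3).trans (lintegral_mono fun u => ?_)
  have hN0 : (1 : ℝ) ≤ N := by exact_mod_cast hN
  have he := Real.exp_pos (β * gsm lam u)
  split_ifs with hu
  · refine le_trans ?_ (mul_le_mul_right (le_volume_LamBox_inter hN hu) _)
    rw [← ENNReal.ofReal_mul he.le]
    refine ENNReal.ofReal_le_ofReal ?_
    have hu2 : ‖u‖ ^ 2 ≤ 1 := pow_le_one₀ (norm_nonneg u) hu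
    rw [min_eq_right hu2]
    have hs := Real.sq_sqrt (Nat.cast_nonneg (α := ℝ) N)
    have h1 : 2 * Real.sqrt N * ‖u‖ ≤ 1 / 8 + 8 * N * ‖u‖ ^ 2 := by
      have h2 : (Real.sqrt N * ‖u‖) ^ 2 = N * ‖u‖ ^ 2 := by rw [mul_pow, hs]
      nlinarith [sq_nonneg (8 * (Real.sqrt N * ‖u‖) - 1)]
    nlinarith [mul_le_mul_of_nonneg_left h1 he.le]
  · rw [min_eq_left (one_le_pow₀ (not_le.1 hu).le), ENNReal.ofReal_of_nonpos]
    · exact zero_le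
    · nlinarith

theorem lintegral_dipoleLaw_log_le {C : ℝ} (hC0 : 0 < C)
    (hC : ∀ (lam ρ : ℝ) (x : E2), 0 < lam → 0 < ρ →
      ∫⁻ y : E2, ENNReal.ofReal (Real.log (1 + ((lam + ‖x - y‖) ^ 4)⁻¹ / (ρ ^ 4)⁻¹)) ≤
        ENNReal.ofReal (C * ρ ^ 2))
    (N : ℕ) {β lam M : ℝ} (hβ : 2 < β) (hl : 0 < lam) (hM : 0 < M) :
    ∫⁻ d, ∫⁻ d', ENNReal.ofReal (Real.log (1 +
        ((lam + ‖d.1 - d'.2‖) ^ 4)⁻¹ / ((lam + ‖d.1 - d.2‖) ^ 4)⁻¹))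
        ∂(dipoleLaw (volume.restrict (LamBox N)) (cutKernel N β lam) nearPairs M)
        ∂(dipoleLaw (volume.restrict (LamBox N)) (cutKernel N β lam) nearPairs M) ≤
      ENNReal.ofReal (lam ^ (2 - β) * Zbeta β / M * C *
        (N * (lam ^ (2 - β) * (2 * lam ^ 2 * Zbeta β + 2 * tailMoment β lam) / M))) := by
  have hZ := Zbeta_pos hβ
  have hgm := Real.measurable_exp.comp ((measurable_gsm hl).const_mul β)
  have hi1 := integrable_exp_gsm hl hβ
  have hi2 := integrable_min_one_sq_mul_exp_gsm hl hβ
  have hk : ∀ y : E2, ∫⁻ x in LamBox N, ENNReal.ofReal (Real.exp (β * gsm lam (x - y)) / M) ≤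
      ENNReal.ofReal (lam ^ (2 - β) * Zbeta β / M) := fun y => by
    refine (setLIntegral_le_lintegral _ _).trans_eq ?_
    rw [← ofReal_integral_eq_lintegral_ofReal ((hi1.comp_sub_right y).div_const M)
      (Filter.Eventually.of_forall fun x => by positivity), integral_div,
      integral_sub_right_eq_self (fun u : E2 => Real.exp (β * gsm lam u)) y,
      integral_exp_gsm hl hβ]
  have hinner : ∀ d : E2 × E2, ∫⁻ d', ENNReal.ofReal (Real.log (1 +
        ((lam + ‖d.1 - d'.2‖) ^ 4)⁻¹ / ((lam + ‖d.1 - d.2‖) ^ 4)⁻¹))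
        ∂(dipoleLaw (volume.restrict (LamBox N)) (cutKernel N β lam) nearPairs M) ≤
      ENNReal.ofReal (lam ^ (2 - β) * Zbeta β / M * C * (lam + ‖d.1 - d.2‖) ^ 2) := by
    intro d
    set G : E2 → ℝ≥0∞ := fun y => ENNReal.ofReal (Real.log (1 +
      ((lam + ‖d.1 - y‖) ^ 4)⁻¹ / ((lam + ‖d.1 - d.2‖) ^ 4)⁻¹)) with hG
    have hGm : Measurable G := by fun_prop
    have hwm : Measurable fun p : E2 × E2 =>
        ENNReal.ofReal (Real.exp (β * gsm lam (p.1 - p.2)) / M) * G p.2 :=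
      ((hgm.comp (measurable_fst.sub measurable_snd)).div_const M).ennreal_ofReal.mul
        (hGm.comp measurable_snd)
    refine (lintegral_dipoleLaw_le (f := fun d' => G d'.2)
      (F := fun p => ENNReal.ofReal (Real.exp (β * gsm lam (p.1 - p.2)) / M) * G p.2) hl
      (hGm.comp measurable_snd) fun _ _ => le_rfl).trans ?_
    rw [lintegral_lintegral_swap hwm.aemeasurable]
    calc ∫⁻ y in LamBox N, ∫⁻ x in LamBox N,
          ENNReal.ofReal (Real.exp (β * gsm lam (x - y)) / M) * G y
        ≤ ∫⁻ y in LamBox N, ENNReal.ofReal (lam ^ (2 - β) * Zbeta β / M) * G y := by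
          refine lintegral_mono fun y => ?_
          have hy : Measurable fun x : E2 =>
              ENNReal.ofReal (Real.exp (β * gsm lam (x - y)) / M) :=
            ((hgm.comp (measurable_id.sub_const y)).div_const M).ennreal_ofReal
          rw [lintegral_mul_const _ hy]
          gcongr
          exact hk y
      _ ≤ ENNReal.ofReal (lam ^ (2 - β) * Zbeta β / M) *
          ENNReal.ofReal (C * (lam + ‖d.1 - d.2‖) ^ 2) := by
          rw [lintegral_const_mul _ hGm]
          gcongr
          exact (setLIntegral_le_lintegral _ _).trans (hC lam _ d.1 hl (by positivity))
      _ = _ := by rw [← ENNReal.ofReal_mul (by positivity)]; ring_nf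
  have hF : Measurable fun u : E2 => ENNReal.ofReal ((2 * lam ^ 2 * Real.exp (β * gsm lam u) +
      2 * (min 1 (‖u‖ ^ 2) * Real.exp (β * gsm lam u))) / M) :=
    (((hgm.const_mul _).add ((Measurable.mul (by fun_prop) hgm).const_mul 2)).div_const
      M).ennreal_ofReal
  refine (lintegral_mono hinner).trans ?_
  simp_rw [ENNReal.ofReal_mul (by positivity : 0 ≤ lam ^ (2 - β) * Zbeta β / M * C)]
  rw [lintegral_const_mul _ (by fun_prop)]
  gcongr
  refine (lintegral_dipoleLaw_le (F := fun p => (fun u : E2 =>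
    ENNReal.ofReal ((2 * lam ^ 2 * Real.exp (β * gsm lam u) +
      2 * (min 1 (‖u‖ ^ 2) * Real.exp (β * gsm lam u))) / M)) (p.1 - p.2)) hl
    (by fun_prop) fun d hd => ?_).trans ?_
  · rw [← ENNReal.ofReal_mul (by positivity)]
    refine ENNReal.ofReal_le_ofReal ?_
    have hd1 : ‖d.1 - d.2‖ ≤ 1 := hd
    rw [min_eq_right (pow_le_one₀ (norm_nonneg _) hd1), div_mul_eq_mul_div]
    gcongr
    have he := Real.exp_pos (β * gsm lam (d.1 - d.2))
    nlinarith [sq_nonneg (lam - ‖d.1 - d.2‖)]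
  · refine (lintegral_lintegral_sub_le (measurableSet_LamBox N) hF).trans_eq ?_
    rw [volume_LamBox, ENNReal.ofReal_mul (Nat.cast_nonneg N)]
    congr 1
    have hi3 : Integrable fun u : E2 => (2 * lam ^ 2 * Real.exp (β * gsm lam u) +
        2 * (min 1 (‖u‖ ^ 2) * Real.exp (β * gsm lam u))) / M :=
      ((hi1.const_mul _).add (hi2.const_mul _)).div_const M
    rw [← ofReal_integral_eq_lintegral_ofReal hi3
      (Filter.Eventually.of_forall fun u => ?_), integral_div,
      integral_add (hi1.const_mul _) (hi2.const_mul _), integral_const_mul, integral_const_mul,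
      integral_exp_gsm hl hβ, integral_min_one_sq_mul_exp_gsm hl]
    · ring_nf
    · have := min_one_sq_nonneg ‖u‖
      simp only [Pi.zero_apply]
      positivity

theorem Zpart_eq_integral_pairEnergy (N : ℕ) (β lam : ℝ) :
    Zpart N β lam = ∫ p : (Fin N → E2) × (Fin N → E2),
      Real.exp (-pairEnergy N (cutKernel N β lam) (β * (-Real.log lam + kappa)) p.1 p.2)
      ∂((Measure.pi fun _ => volume.restrict (LamBox N)).prod
        (Measure.pi fun _ => volume.restrict (LamBox N))) := by
  have hset : (Set.univ.pi fun _ : Fin N => LamBox N) ×ˢ (Set.univ.pi fun _ : Fin N => LamBox N) =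
      confSet N := by
    ext p; simp [confSet]
  rw [← Measure.restrict_pi_pi, Measure.prod_restrict, hset, ← volume_pi,
    ← Measure.volume_eq_prod, Zpart]
  have hmeas : MeasurableSet (confSet N) := by
    rw [← hset]
    exact (MeasurableSet.univ_pi fun _ => measurableSet_LamBox N).prod
      (MeasurableSet.univ_pi fun _ => measurableSet_LamBox N)
  refine setIntegral_congr_fun hmeas fun p hp => ?_
  have hX := hp.1
  have hY := hp.2
  simp only [Flam, pairEnergy, cutKernel_of_mem β lam (hX _) (hX _),
    cutKernel_of_mem β lam (hY _) (hY _), cutKernel_of_mem β lam (hX _) (hY _)]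
  congr 1
  have h : ∀ i j, β * gsm lam (p.1 i - p.1 j) + β * gsm lam (p.2 i - p.2 j) -
      2 * (β * gsm lam (p.1 i - p.2 j)) = β * (gsm lam (p.1 i - p.1 j) +
        gsm lam (p.2 i - p.2 j) - 2 * gsm lam (p.1 i - p.2 j)) := fun i j => by ring
  simp_rw [h, ← Finset.mul_sum]
  ring

theorem le_Zpart {C : ℝ} (hC0 : 0 < C)
    (hC : ∀ (lam ρ : ℝ) (x : E2), 0 < lam → 0 < ρ →
      ∫⁻ y : E2, ENNReal.ofReal (Real.log (1 + ((lam + ‖x - y‖) ^ 4)⁻¹ / (ρ ^ 4)⁻¹)) ≤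
        ENNReal.ofReal (C * ρ ^ 2))
    (N : ℕ) {β lam e : ℝ} (hβ : 2 < β) (hl : 0 < lam) (hM : 0 < dipoleMass N β lam) (he0 : 0 ≤ e)
    (he : lam ^ (2 - β) * Zbeta β / dipoleMass N β lam * C * (N * (lam ^ (2 - β) *
      (2 * lam ^ 2 * Zbeta β + 2 * tailMoment β lam) / dipoleMass N β lam)) ≤ e) :
    N.factorial * dipoleMass N β lam ^ N * Real.exp (-(N * (N - 1) * e)) ≤ Zpart N β lam := by
  obtain ⟨B, hB⟩ := exists_abs_cutKernel_le N β hl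
  rw [Zpart_eq_integral_pairEnergy]
  refine partition_lower_bound (volume.restrict (LamBox N)) N (S := nearPairs)
    (h := fun x y => ((lam + ‖x - y‖) ^ 4)⁻¹) (measurable_cutKernel N β hl)
    (cutKernel_symm N β hl) (cutKernel_self N β hl) hB (by fun_prop)
    (fun x y => by positivity) measurableSet_nearPairs (fun d => ?_) rfl hM he0
    ((lintegral_dipoleLaw_log_le hC0 hC N hβ hl hM).trans (ENNReal.ofReal_le_ofReal he))
  simp [nearPairs, norm_sub_rev]

theorem le_log_factorial {N : ℕ} (hN : 1 ≤ N) :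
    1 / 4 + N * Real.log N - N ≤ Real.log N.factorial := by
  have hN0 : (1 : ℝ) ≤ N := by exact_mod_cast hN
  have hNp : (0 : ℝ) < N := by linarith
  have h1 : 2 ≤ 2 * π * N := by nlinarith [pi_gt_three]
  refine le_trans ?_ (Real.log_le_log (by positivity) (Stirling.le_factorial_stirling N))
  rw [Real.log_mul (by positivity) (by positivity), Real.log_pow, Real.log_sqrt (by positivity),
    Real.log_div (by positivity) (by positivity), Real.log_exp]
  have h2 := Real.log_le_log two_pos h1
  linarith [Real.log_two_gt_d9]

theorem neg_two_mul_le_log_one_sub {δ : ℝ} (h0 : 0 ≤ δ) (h1 : δ ≤ 1 / 2) :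
    -(2 * δ) ≤ Real.log (1 - δ) := by
  have h2 : (0 : ℝ) < 1 - δ := by linarith
  refine le_trans ?_ (Real.one_sub_inv_le_log_of_pos h2)
  have h3 : (1 - δ)⁻¹ ≤ 1 + 2 * δ := by
    rw [inv_le_iff_one_le_mul₀ h2]; nlinarith
  linarith

theorem log_Zpart_ge {C : ℝ} (hC0 : 0 < C)
    (hC : ∀ (lam ρ : ℝ) (x : E2), 0 < lam → 0 < ρ →
      ∫⁻ y : E2, ENNReal.ofReal (Real.log (1 + ((lam + ‖x - y‖) ^ 4)⁻¹ / (ρ ^ 4)⁻¹)) ≤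
        ENNReal.ofReal (C * ρ ^ 2))
    {N : ℕ} (hN : 1 ≤ N) {β lam : ℝ} (hβ : 2 < β) (hl : 0 < lam)
    (hm : tailMoment β lam ≤ Zbeta β / 32) :
    2 * N * Real.log N + N * (2 - β) * Real.log lam + N * (Real.log (Zbeta β) - 1) -
      (8 * C + 8 * C / Zbeta β + 16 / Zbeta β) * N * (lam ^ 2 + tailMoment β lam) ≤
      Real.log (Zpart N β lam) := by
  have hZ := Zbeta_pos hβ
  have hm0 := tailMoment_nonneg β lam
  have hN0 : (1 : ℝ) ≤ N := by exact_mod_cast hN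
  have hNp : (0 : ℝ) < N := by linarith
  have hL : 0 < lam ^ (2 - β) := by positivity
  have hlow := le_dipoleMass hN hβ hl
  set Z := Zbeta β with hZdef
  set m := tailMoment β lam with hmdef
  set M := dipoleMass N β lam with hMdef
  set L := lam ^ (2 - β) with hLdef
  set δ := 1 / (8 * N) + 8 * m / Z with hδ
  have hδ0 : 0 ≤ δ := by positivity
  have hδ1 : δ ≤ 1 / 2 := by
    have h1 : 1 / (8 * (N : ℝ)) ≤ 1 / 8 := one_div_le_one_div_of_le (by norm_num) (by linarith)
    have h2 : 8 * m / Z ≤ 1 / 4 := by rw [div_le_iff₀ hZ]; linarith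
    linarith
  have hlow' : L * N * Z * (1 - δ) ≤ M := by
    refine le_of_eq_of_le ?_ hlow
    rw [hδ]
    field_simp
    ring
  have hLNZ : 0 < L * N * Z := by positivity
  have hhalf : L * N * Z / 2 ≤ M := by nlinarith
  have hM : 0 < M := lt_of_lt_of_le (by positivity) hhalf
  have ha : L * Z / M ≤ 2 / N := by
    rw [div_le_div_iff₀ hM hNp]; linarith
  have hb : N * (L * (2 * lam ^ 2 * Z + 2 * m) / M) ≤ 4 * (lam ^ 2 + m / Z) := by
    have h1 : N * (L * (2 * lam ^ 2 * Z + 2 * m) / M) =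
        N * (L * Z / M) * (2 * (lam ^ 2 + m / Z)) := by field_simp
    have h2 : N * (L * Z / M) ≤ 2 := by
      refine (mul_le_mul_of_nonneg_left ha hNp.le).trans_eq ?_
      field_simp
    rw [h1]
    have h3 : 0 ≤ 2 * (lam ^ 2 + m / Z) := by positivity
    nlinarith
  have hZp := le_Zpart hC0 hC N (e := 2 / N * C * (4 * (lam ^ 2 + m / Z))) hβ hl hM
    (by positivity) (by gcongr)
  have hlog := Real.log_le_log (by positivity) hZp
  rw [Real.log_mul (by positivity) (by positivity), Real.log_mul (by positivity) (by positivity),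
    Real.log_pow, Real.log_exp] at hlog
  have hlogM : Real.log L + Real.log N + Real.log Z - 2 * δ ≤ Real.log M := by
    have h1 := Real.log_le_log (mul_pos hLNZ (by linarith)) hlow'
    rw [Real.log_mul hLNZ.ne' (by linarith), Real.log_mul (by positivity) hZ.ne',
      Real.log_mul hL.ne' hNp.ne'] at h1
    linarith [neg_two_mul_le_log_one_sub hδ0 hδ1]
  have hlogL : Real.log L = (2 - β) * Real.log lam := Real.log_rpow hl _
  have hfac := le_log_factorial hN
  have hNlogM := mul_le_mul_of_nonneg_left hlogM hNp.le
  have hNδ : N * (2 * δ) = 1 / 4 + 16 / Z * N * m := by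
    rw [hδ]; field_simp; ring
  have henergy : N * (N - 1) * (2 / N * C * (4 * (lam ^ 2 + m / Z))) ≤
      N * (8 * C * (lam ^ 2 + m / Z)) := by
    have h1 : N * (N - 1) * (2 / N * C * (4 * (lam ^ 2 + m / Z))) =
        (N - 1) * (8 * C * (lam ^ 2 + m / Z)) := by field_simp; ring
    rw [h1]
    refine mul_le_mul_of_nonneg_right (by linarith) (by positivity)
  have hrest : N * (8 * C * (lam ^ 2 + m / Z)) + 16 / Z * N * m ≤
      (8 * C + 8 * C / Z + 16 / Z) * N * (lam ^ 2 + m) := by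
    have h1 : 0 ≤ 8 * C * N * m + (8 * C / Z + 16 / Z) * N * lam ^ 2 := by positivity
    have h2 : N * (8 * C * (lam ^ 2 + m / Z)) = 8 * C * N * lam ^ 2 + 8 * C / Z * N * m := by
      ring
    have h3 : (8 * C + 8 * C / Z + 16 / Z) * N * (lam ^ 2 + m) =
        8 * C * N * lam ^ 2 + 8 * C / Z * N * m + 16 / Z * N * m +
          (8 * C * N * m + (8 * C / Z + 16 / Z) * N * lam ^ 2) := by ring
    linarith
  rw [hlogL] at hNlogM
  have hsplit : N * ((2 - β) * Real.log lam + Real.log N + Real.log Z - 2 * δ) =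
      N * (2 - β) * Real.log lam + N * Real.log N + N * Real.log Z - N * (2 * δ) := by ring
  linarith

/-- Free energy lower bound for `β > 2` (Proposition 4.1, first part). -/
theorem statement5 (β : ℝ) (hβ : 2 < β) :
    ∃ C lam0 : ℝ, 0 < C ∧ 0 < lam0 ∧ lam0 < 1/2 ∧
      ∀ lam : ℝ, 0 < lam → lam < lam0 → ∀ N : ℕ, 1 ≤ N →
        2 * N * Real.log N + N * (2 - β) * Real.log lam +
            N * (Real.log (Zbeta β) - 1) -
            C * N * ((if β < 4 then lam ^ (β - 2) else 0) +
                     (if β = 4 then lam ^ 2 * |Real.log lam| ^ 2 else 0) +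
                     (if 4 < β then lam ^ 2 * |Real.log lam| else 0)) ≤
          Real.log (Zpart N β lam) := by
  obtain ⟨C, hC0, hC⟩ := lintegral_log_one_add_le
  obtain ⟨C', hC'0, hC'⟩ := sq_add_tailMoment_le hβ
  have hZ := Zbeta_pos hβ
  obtain ⟨lam0, hlam0, hm⟩ := tendsto_tailMoment hβ (η := Zbeta β / 32) (by positivity)
  set D := 8 * C + 8 * C / Zbeta β + 16 / Zbeta β with hD
  have hD0 : 0 < D := by positivity
  refine ⟨D * C', min lam0 (1 / 4), by positivity, by positivity,
    (min_le_right _ _).trans_lt (by norm_num), fun lam hl hlt N hN => ?_⟩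
  have hmain := log_Zpart_ge hC0 hC hN hβ hl (hm lam hl (hlt.trans_le (min_le_left _ _)))
  refine le_trans (sub_le_sub_left ?_ _) hmain
  have h := mul_le_mul_of_nonneg_left (hC' lam hl (hlt.trans_le (min_le_right _ _)).le)
    (by positivity : 0 ≤ D * N)
  exact h.trans_eq (by rw [dipoleRate]; ring)
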